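/- arXiv:0912.4713 — 2 statements merged into one kernel-verified Lean document; each statement's English description precedes it below -/
import Mathlib

section
/- Suppose Γ is finite, H : Γ ⇉ Γ is a set-valued map, and (x,σ) is a forward complete trajectory of the switched system ẋ = f(x,σ) with σ ∈ S_d ∩ S^H; suppose Assumptions (E0) and (U) hold. (1) If Assumption (A5) holds, 0 ∈ O, and (i) either O_γ^f(f_γ,W_γ,∞) ⊆ {0} for every γ ∈ Γ or O_γ^b(f_γ,W_γ,∞) ⊆ {0} for every γ ∈ Γ, and (ii) for each simple cycle {γ_i}_{i=1}^m of H there exists j ∈ {1,…,m−1} with O_{γ_j}^b(f_{γ_j},W_{γ_j}) ∩ O_{γ_{j+1}}^f(f_{γ_{j+1}},W_{γ_{j+1}}) ⊆ {0}, then x(t) → 0 as t → +∞. (2) The same conclusion holds if Assumption (A5) is replaced by Assumption (A3) and (ii) is replaced by the weaker condition: for every c ∈ ℝ and each simple cycle {γ_i}_{i=1}^m of H there exists j ∈ {1,…,m−1} with O_{γ_j}^b(f_{γ_j},W_{γ_j}) ∩ O_{γ_{j+1}}^f(f_{γ_{j+1}},W_{γ_{j+1}}) ∩ V_{γ_j}⁻¹(c)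 ∩ V_{γ_{j+1}}⁻¹(c) ⊆ {0}. -/
open Filter Topology MeasureTheory Set

noncomputable section

abbrev Eucl (n : ℕ) : Type := EuclideanSpace ℝ (Fin n)

/-- The set of discontinuity (switching) times of a signal. -/
def JumpTimes {Γ : Type*} [TopologicalSpace Γ] (σ : ℝ → Γ) : Set ℝ :=
  {t | ¬ ContinuousAt σ t}

/-- A switching signal: piecewise constant (finitely many discontinuities in every
compact interval, locally constant to the right and on a left punctured neighborhood
of every point) and continuous from the right. -/
structure IsSwitchingSignal {Γ : Type*} [TopologicalSpace Γ] (σ : ℝ → Γ) : Prop where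
  locFinite : ∀ a b : ℝ, (JumpTimes σ ∩ Set.Icc a b).Finite
  rightConst : ∀ t : ℝ, ∃ ε > (0:ℝ), ∀ s ∈ Set.Ico t (t + ε), σ s = σ t
  leftConst : ∀ t : ℝ, ∃ ε > (0:ℝ), ∀ s ∈ Set.Ioo (t - ε) t, ∀ s' ∈ Set.Ioo (t - ε) t, σ s = σ s'

/-- `SA Γ τD N₀` : switching signals with average dwell time `τD` and chatter bound `N₀`. -/
def SA (Γ : Type*) [TopologicalSpace Γ] (τD : ℝ) (N₀ : ℕ) : Set (ℝ → Γ) :=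
  {σ | IsSwitchingSignal σ ∧ ∀ τ₁ τ₂ : ℝ, τ₁ < τ₂ →
    ((JumpTimes σ ∩ Set.Ioo τ₁ τ₂).ncard : ℝ) ≤ (N₀ : ℝ) + (τ₂ - τ₁) / τD}

def SAall (Γ : Type*) [TopologicalSpace Γ] : Set (ℝ → Γ) :=
  ⋃ τD ∈ Set.Ioi (0 : ℝ), ⋃ N₀ : ℕ, SA Γ τD N₀

/-- Dwell-time signals. -/
def SD (Γ : Type*) [TopologicalSpace Γ] (τD : ℝ) : Set (ℝ → Γ) := SA Γ τD 1

def SDall (Γ : Type*) [TopologicalSpace Γ] : Set (ℝ → Γ) :=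
  ⋃ τD ∈ Set.Ioi (0 : ℝ), SD Γ τD

/-- First switching time strictly greater than `t` (`⊤` if none). -/
def tau1 {Γ : Type*} [TopologicalSpace Γ] (σ : ℝ → Γ) (t : ℝ) : EReal :=
  sInf (Real.toEReal '' (JumpTimes σ ∩ Set.Ioi t))

/-- The class `S^H` of switching signals compatible with the set-valued map `H`:
at each switching time the new value belongs to `H` of the left limit. -/
def SH {Γ : Type*} [TopologicalSpace Γ] (H : Γ → Set Γ) : Set (ℝ → Γ) :=
  {σ | ∀ t ∈ JumpTimes σ, ∀ γ' : Γ,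
    Filter.Tendsto σ (nhdsWithin t (Set.Iio t)) (nhds γ') → σ t ∈ H γ'}

/-- The "ergodic" class `S_e[T]`. -/
def SE (Γ : Type*) [TopologicalSpace Γ] (T : ℝ) : Set (ℝ → Γ) :=
  {σ | ∀ t₀ : ℝ, 0 ≤ t₀ → ∀ γ : Γ, ∃ t ∈ Set.Icc t₀ (t₀ + T), σ t = γ}

def SEall (Γ : Type*) [TopologicalSpace Γ] : Set (ℝ → Γ) :=
  ⋃ T ∈ Set.Ioi (0 : ℝ), SE Γ T

/-- Property P of a family of switching signals. -/
def HasPropertyP {Γ : Type*} [TopologicalSpace Γ] (S : Set (ℝ → Γ)) : Prop :=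
  (∃ τD > (0 : ℝ), ∃ N₀ : ℕ, S ⊆ SA Γ τD N₀) ∧
  (∀ σ ∈ S, ∀ s > (0 : ℝ), (fun t => σ (t + s)) ∈ S) ∧
  (∀ σseq : ℕ → ℝ → Γ, (∀ k, σseq k ∈ S) →
    ∃ σstar ∈ S, ∃ φ : ℕ → ℕ, StrictMono φ ∧
      ∀ᵐ t ∂(volume : Measure ℝ),
        Filter.Tendsto (fun l => σseq (φ l) t) Filter.atTop (nhds (σstar t)))

/-- A solution of `ẋ = g(x)` with values in `X`, on the set `I`. -/
def IsSolOn {n : ℕ} (g : Eucl n → Eucl n) (X : Set (Eucl n)) (φ : ℝ → Eucl n) (I : Set ℝ) : Prop :=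
  ContinuousOn φ I ∧ (∀ t ∈ I, φ t ∈ X) ∧
  ∀ t₀ ∈ I, ∀ t ∈ I,
    IntervalIntegrable (fun s => g (φ s)) volume t₀ t ∧
    φ t = φ t₀ + ∫ s in t₀..t, g (φ s)

/-- A trajectory of the switched system `ẋ = f(x,σ)` on the interval `I`. -/
structure IsTrajectory {n : ℕ} {Γ : Type*} [TopologicalSpace Γ]
    (f : Eucl n × Γ → Eucl n) (domf : Set (Eucl n × Γ))
    (x : ℝ → Eucl n) (σ : ℝ → Γ) (I : Set ℝ) : Prop where
  signal : IsSwitchingSignal σ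
  nonempty : I.Nonempty
  ordConn : I.OrdConnected
  cont : ContinuousOn x I
  mem : ∀ t ∈ I, (x t, σ t) ∈ domf
  intg : ∀ t₀ ∈ I, ∀ t ∈ I,
    IntervalIntegrable (fun s => f (x s, σ s)) volume t₀ t ∧
    x t = x t₀ + ∫ s in t₀..t, f (x s, σ s)

/-- Precompactness of a trajectory relative to `O`. -/
def PrecompactRel {n : ℕ} (x : ℝ → Eucl n) (I : Set ℝ) (O : Set (Eucl n)) : Prop :=
  ∃ B : Set (Eucl n), B ⊆ O ∧ IsCompact B ∧ ∀ t ∈ I, x t ∈ B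

/-- ω-limit set of `x` defined on `I`. -/
def OmegaLimit {n : ℕ} (x : ℝ → Eucl n) (I : Set ℝ) : Set (Eucl n) :=
  {ξ | ∃ s : ℕ → ℝ, StrictMono s ∧ (∀ k, s k ∈ I) ∧
    Filter.Tendsto s Filter.atTop Filter.atTop ∧
    Filter.Tendsto (fun k => x (s k)) Filter.atTop (nhds ξ)}

/-- The set `Ω♯(x,σ)`. -/
def OmegaSharp {n : ℕ} {Γ : Type*} [TopologicalSpace Γ] (x : ℝ → Eucl n) (σ : ℝ → Γ) :
    Set (Eucl n × Γ) :=
  {p | ∃ s : ℕ → ℝ, StrictMono s ∧ (∀ k, 0 ≤ s k) ∧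
    Filter.Tendsto s Filter.atTop Filter.atTop ∧
    (∃ r : EReal, 0 < r ∧
      Filter.Tendsto (fun k => tau1 σ (s k) - Real.toEReal (s k)) Filter.atTop (nhds r)) ∧
    Filter.Tendsto (fun k => x (s k)) Filter.atTop (nhds p.1) ∧
    Filter.Tendsto (fun k => σ (s k)) Filter.atTop (nhds p.2)}

/-- Weak invariance of `M` w.r.t. the family of complete trajectories `T`
(without the nonemptiness requirement). -/
def WeaklyInvariantCore {n : ℕ} {Γ : Type*} (T : Set ((ℝ → Eucl n) × (ℝ → Γ)))
    (M : Set (Eucl n × Γ)) : Prop :=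
  ∀ p ∈ M, ∃ xs ∈ T, xs.1 0 = p.1 ∧ xs.2 0 = p.2 ∧ ∀ t : ℝ, (xs.1 t, xs.2 t) ∈ M

/-- Weak invariance of a nonempty set `M` w.r.t. `T`. -/
def WeaklyInvariant {n : ℕ} {Γ : Type*} (T : Set ((ℝ → Eucl n) × (ℝ → Γ)))
    (M : Set (Eucl n × Γ)) : Prop :=
  M.Nonempty ∧ WeaklyInvariantCore T M

/-- Maximal weakly invariant subset of `S` w.r.t. `T`. -/
def MaxWeaklyInvariantIn {n : ℕ} {Γ : Type*} (T : Set ((ℝ → Eucl n) × (ℝ → Γ)))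
    (S : Set (Eucl n × Γ)) : Set (Eucl n × Γ) :=
  ⋃₀ {M | M ⊆ S ∧ WeaklyInvariantCore T M}

/-- All complete trajectories whose switching signal lies in `S`. -/
def TrajOf {n : ℕ} {Γ : Type*} [TopologicalSpace Γ] (f : Eucl n × Γ → Eucl n)
    (domf : Set (Eucl n × Γ)) (S : Set (ℝ → Γ)) : Set ((ℝ → Eucl n) × (ℝ → Γ)) :=
  {xs | IsTrajectory f domf xs.1 xs.2 Set.univ ∧ xs.2 ∈ S}

/-- `x → M` : convergence of `x(t)` to the set `M` as `t → +∞`. -/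
def ConvergesTo {n : ℕ} (x : ℝ → Eucl n) (M : Set (Eucl n)) : Prop :=
  Filter.Tendsto (fun t => Metric.infDist (x t) M) Filter.atTop (nhds 0)

def Oset {n : ℕ} {Γ : Type*} (domV : Set (Eucl n × Γ)) : Set (Eucl n) := Prod.fst '' domV

def Ogamma {n : ℕ} {Γ : Type*} (domV domf : Set (Eucl n × Γ)) (γ : Γ) : Set (Eucl n) :=
  {ξ | ξ ∈ Oset domV ∧ (ξ, γ) ∈ domf}

/-- The class 𝒱 of functions. -/
structure ClassVFun {n : ℕ} {Γ : Type*} (V : Eucl n × Γ → ℝ)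
    (domV domf : Set (Eucl n × Γ)) : Prop where
  openD : ∀ γ : Γ, IsOpen {ξ : Eucl n | (ξ, γ) ∈ domV}
  subD : ∀ γ : Γ, ∀ ξ ∈ Ogamma domV domf γ, (ξ, γ) ∈ domV
  diff : ∀ γ : Γ, ∀ ξ ∈ Ogamma domV domf γ, DifferentiableAt ℝ (fun ξ' => V (ξ', γ)) ξ

/-- The set `Z_V`. -/
def ZV {n : ℕ} {Γ : Type*} (f : Eucl n × Γ → Eucl n) (V : Eucl n × Γ → ℝ)
    (domV domf : Set (Eucl n × Γ)) : Set (Eucl n × Γ) :=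
  {p | p ∈ domf ∧ p.1 ∈ Oset domV ∧ fderiv ℝ (fun ξ' => V (ξ', p.2)) p.1 (f p) = 0}

/-- Assumption (A1). -/
structure AssumptionA1 {n : ℕ} {Γ : Type*} [TopologicalSpace Γ]
    (domf : Set (Eucl n × Γ)) (V : Eucl n × Γ → ℝ) (domV : Set (Eucl n × Γ))
    (x : ℝ → Eucl n) (σ : ℝ → Γ) (I : Set ℝ) : Prop where
  classV : ClassVFun V domV domf
  contV : ContinuousOn V (domf ∩ (Oset domV ×ˢ (Set.univ : Set Γ)))
  precompact : PrecompactRel x I (Oset domV)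
  nonincr : AntitoneOn (fun t => V (x t, σ t)) (Set.Ici 0)

/-- Assumption (A2) (for finite Γ). -/
structure AssumptionA2 {n : ℕ} {Γ : Type*} [TopologicalSpace Γ]
    (domf : Set (Eucl n × Γ)) (V : Eucl n × Γ → ℝ) (domV : Set (Eucl n × Γ))
    (x : ℝ → Eucl n) (σ : ℝ → Γ) (I : Set ℝ) : Prop where
  classV : ClassVFun V domV domf
  precompact : PrecompactRel x I (Oset domV)
  nonincr : ∀ γ : Γ, AntitoneOn (fun t => V (x t, σ t)) ({t | σ t = γ} ∩ Set.Ici 0)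

/-- The inequality `−∇V_γ(ξ)·f_γ(ξ) ≥ W_γ(ξ) ≥ 0` on each `O_γ`. -/
def Wineq {n : ℕ} {Γ : Type*} (f : Eucl n × Γ → Eucl n) (V W : Eucl n × Γ → ℝ)
    (domV domf : Set (Eucl n × Γ)) : Prop :=
  ∀ γ : Γ, ∀ ξ ∈ Ogamma domV domf γ,
    W (ξ, γ) ≤ -(fderiv ℝ (fun ξ' => V (ξ', γ)) ξ (f (ξ, γ))) ∧ 0 ≤ W (ξ, γ)

/-- Assumption (A4). -/
structure AssumptionA4 {n : ℕ} {Γ : Type*} [TopologicalSpace Γ] (f : Eucl n × Γ → Eucl n)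
    (domf : Set (Eucl n × Γ)) (V : Eucl n × Γ → ℝ) (domV : Set (Eucl n × Γ))
    (W : Eucl n × Γ → ℝ) (x : ℝ → Eucl n) (σ : ℝ → Γ) (I : Set ℝ) : Prop where
  classV : ClassVFun V domV domf
  boundedV : ∀ K : Set (Eucl n × Γ), K ⊆ domf ∩ (Oset domV ×ˢ (Set.univ : Set Γ)) →
    IsCompact K → ∃ M : ℝ, ∀ p ∈ K, |V p| ≤ M
  precompact : PrecompactRel x I (Oset domV)
  nonincr : AntitoneOn (fun t => V (x t, σ t)) (Set.Ici 0)
  wineq : Wineq f V W domV domf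
  contW : ContinuousOn W (domf ∩ (Oset domV ×ˢ (Set.univ : Set Γ)))

/-- The set `X^f(g,h,τ)` for finite `τ`. -/
def XFwd {n : ℕ} (X : Set (Eucl n)) (g : Eucl n → Eucl n) (h : Eucl n → ℝ) (τ : ℝ) :
    Set (Eucl n) :=
  {ξ | ∃ φ : ℝ → Eucl n, IsSolOn g X φ (Set.Icc 0 τ) ∧ φ 0 = ξ ∧
    ∀ t ∈ Set.Icc (0 : ℝ) τ, h (φ t) = 0}

/-- The set `X^b(g,h,τ)` for finite `τ`. -/
def XBwd {n : ℕ} (X : Set (Eucl n)) (g : Eucl n → Eucl n) (h : Eucl n → ℝ) (τ : ℝ) :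
    Set (Eucl n) :=
  {ξ | ∃ φ : ℝ → Eucl n, IsSolOn g X φ (Set.Icc (-τ) 0) ∧ φ 0 = ξ ∧
    ∀ t ∈ Set.Icc (-τ) (0 : ℝ), h (φ t) = 0}

/-- The set `X^f(g,h,∞)`. -/
def XFwdInf {n : ℕ} (X : Set (Eucl n)) (g : Eucl n → Eucl n) (h : Eucl n → ℝ) :
    Set (Eucl n) :=
  {ξ | ∃ φ : ℝ → Eucl n, IsSolOn g X φ (Set.Ici 0) ∧ φ 0 = ξ ∧
    ∀ t ∈ Set.Ici (0 : ℝ), h (φ t) = 0}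

/-- The set `X^b(g,h,∞)`. -/
def XBwdInf {n : ℕ} (X : Set (Eucl n)) (g : Eucl n → Eucl n) (h : Eucl n → ℝ) :
    Set (Eucl n) :=
  {ξ | ∃ φ : ℝ → Eucl n, IsSolOn g X φ (Set.Iic 0) ∧ φ 0 = ξ ∧
    ∀ t ∈ Set.Iic (0 : ℝ), h (φ t) = 0}

/-- `X^f(g,h) = ∪_{τ>0} X^f(g,h,τ)`. -/
def XFwdFin {n : ℕ} (X : Set (Eucl n)) (g : Eucl n → Eucl n) (h : Eucl n → ℝ) :
    Set (Eucl n) :=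
  ⋃ τ ∈ Set.Ioi (0 : ℝ), XFwd X g h τ

/-- `X^b(g,h) = ∪_{τ>0} X^b(g,h,τ)`. -/
def XBwdFin {n : ℕ} (X : Set (Eucl n)) (g : Eucl n → Eucl n) (h : Eucl n → ℝ) :
    Set (Eucl n) :=
  ⋃ τ ∈ Set.Ioi (0 : ℝ), XBwd X g h τ

/-- Weakly meagre functions on `[0,∞)`. -/
def WeaklyMeagre (y : ℝ → ℝ) : Prop :=
  ∀ I : ℕ → Set ℝ, (∀ k, (I k).Nonempty) → (∀ k, I k ⊆ Set.Ici 0) →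
    (∀ k, (I k).OrdConnected) → (Pairwise fun k l => Disjoint (I k) (I l)) →
    (∃ δ : ENNReal, 0 < δ ∧ ∀ k, δ ≤ volume (I k)) →
    Filter.Tendsto (fun k => sInf ((fun t => |y t|) '' I k)) Filter.atTop (nhds 0)

/-- Assumption (E0) : the origin is an equilibrium point of the switched system. -/
def AssumpE0 {n : ℕ} {Γ : Type*} (f : Eucl n × Γ → Eucl n) (domf : Set (Eucl n × Γ)) : Prop :=
  ∀ γ : Γ, ((0 : Eucl n), γ) ∈ domf → f (0, γ) = 0

/-- Assumption (U) : uniqueness of the solution of the IVP `ẋ = f_γ(x)`, `x(0)=0`. -/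
def AssumpU {n : ℕ} {Γ : Type*} (f : Eucl n × Γ → Eucl n) (domf : Set (Eucl n × Γ)) : Prop :=
  ∀ γ : Γ, ((0 : Eucl n), γ) ∈ domf →
    ∀ I : Set ℝ, I.OrdConnected → (0 : ℝ) ∈ I →
    ∀ φ ψ : ℝ → Eucl n,
      IsSolOn (fun ξ => f (ξ, γ)) {ξ | (ξ, γ) ∈ domf} φ I →
      IsSolOn (fun ξ => f (ξ, γ)) {ξ | (ξ, γ) ∈ domf} ψ I →
      φ 0 = 0 → ψ 0 = 0 → ∀ t ∈ I, φ t = ψ t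

/-- The set `E_γ` of equilibrium points of `f_γ`. -/
def Egamma {n : ℕ} {Γ : Type*} (f : Eucl n × Γ → Eucl n) (domf : Set (Eucl n × Γ)) (γ : Γ) :
    Set (Eucl n) :=
  {ξ | (ξ, γ) ∈ domf ∧ f (ξ, γ) = 0}

/-- Discrete subsets of `ℝⁿ`. -/
def IsDiscreteSet {n : ℕ} (S : Set (Eucl n)) : Prop :=
  ∀ ξ ∈ S, ∃ ε > (0 : ℝ), S ∩ Metric.ball ξ ε = {ξ}

/-- Class-K functions (on `[0,∞)`). -/
structure ClassK (α : ℝ → ℝ) : Prop where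
  cont : ContinuousOn α (Set.Ici 0)
  mono : StrictMonoOn α (Set.Ici 0)
  zero : α 0 = 0

/-- Class-K∞ functions. -/
structure ClassKInf (α : ℝ → ℝ) extends ClassK α : Prop where
  unbounded : Filter.Tendsto α Filter.atTop Filter.atTop

/-- Local uniform stability of a family of forward complete trajectories. -/
def FamilyLUS {n : ℕ} {Γ : Type*} (T : Set ((ℝ → Eucl n) × (ℝ → Γ))) : Prop :=
  ∃ r > (0 : ℝ), ∃ α : ℝ → ℝ, ClassK α ∧
    ∀ xs ∈ T, ∀ t₀ : ℝ, 0 ≤ t₀ → ‖xs.1 t₀‖ ≤ r → ∀ t : ℝ, t₀ ≤ t → ‖xs.1 t‖ ≤ α ‖xs.1 t₀‖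

/-- Global uniform stability. -/
def FamilyGUS {n : ℕ} {Γ : Type*} (T : Set ((ℝ → Eucl n) × (ℝ → Γ))) : Prop :=
  ∃ α : ℝ → ℝ, ClassKInf α ∧
    ∀ xs ∈ T, ∀ t₀ : ℝ, 0 ≤ t₀ → ∀ t : ℝ, t₀ ≤ t → ‖xs.1 t‖ ≤ α ‖xs.1 t₀‖

/-- Local asymptotic stability. -/
def FamilyLAS {n : ℕ} {Γ : Type*} (T : Set ((ℝ → Eucl n) × (ℝ → Γ))) : Prop :=
  FamilyLUS T ∧ ∃ η > (0 : ℝ), ∀ xs ∈ T, ‖xs.1 0‖ < η →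
    Filter.Tendsto xs.1 Filter.atTop (nhds 0)

/-- Global asymptotic stability. -/
def FamilyGAS {n : ℕ} {Γ : Type*} (T : Set ((ℝ → Eucl n) × (ℝ → Γ))) : Prop :=
  FamilyGUS T ∧ ∀ xs ∈ T, Filter.Tendsto xs.1 Filter.atTop (nhds 0)

/-- A weak Lyapunov pair `(V,W)` for the family `T`. -/
structure WeakLyapunovPair {n : ℕ} {Γ : Type*} [TopologicalSpace Γ]
    (f : Eucl n × Γ → Eucl n) (domf : Set (Eucl n × Γ)) (V : Eucl n × Γ → ℝ)
    (domV : Set (Eucl n × Γ)) (W : Eucl n × Γ → ℝ)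
    (T : Set ((ℝ → Eucl n) × (ℝ → Γ))) : Prop where
  classV : ClassVFun V domV domf
  zeroMem : (0 : Eucl n) ∈ Oset domV
  bounds : ∃ α₁ α₂ : ℝ → ℝ, ClassK α₁ ∧ ClassK α₂ ∧
    ∀ γ : Γ, ∀ ξ ∈ Ogamma domV domf γ, α₁ ‖ξ‖ ≤ V (ξ, γ) ∧ V (ξ, γ) ≤ α₂ ‖ξ‖
  wineq : Wineq f V W domV domf
  decreasing : ∀ xs ∈ T, ∀ a b : ℝ, 0 ≤ a → a ≤ b →
    (∀ t ∈ Set.Icc a b, xs.1 t ∈ Oset domV) →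
    AntitoneOn (fun t => V (xs.1 t, xs.2 t)) (Set.Icc a b)

/-- An F-weak Lyapunov pair `(V,W)` for the family `T`. -/
structure FWeakLyapunovPair {n : ℕ} {Γ : Type*} [TopologicalSpace Γ]
    (f : Eucl n × Γ → Eucl n) (domf : Set (Eucl n × Γ)) (V : Eucl n × Γ → ℝ)
    (domV : Set (Eucl n × Γ)) (W : Eucl n × Γ → ℝ)
    (T : Set ((ℝ → Eucl n) × (ℝ → Γ))) : Prop where
  classV : ClassVFun V domV domf
  zeroMem : (0 : Eucl n) ∈ Oset domV
  bounds : ∃ α₁ α₂ : ℝ → ℝ, ClassK α₁ ∧ ClassK α₂ ∧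
    ∀ γ : Γ, ∀ ξ ∈ Ogamma domV domf γ, α₁ ‖ξ‖ ≤ V (ξ, γ) ∧ V (ξ, γ) ≤ α₂ ‖ξ‖
  wineq : Wineq f V W domV domf
  decreasing : ∀ xs ∈ T, ∀ a b : ℝ, 0 ≤ a → a ≤ b →
    (∀ t ∈ Set.Icc a b, xs.1 t ∈ Oset domV) →
    ∀ γ : Γ, AntitoneOn (fun t => V (xs.1 t, γ)) (Set.Icc a b ∩ {t | xs.2 t = γ})

/-- `V` is radially unbounded : the class-K bounds may be chosen of class K∞. -/
def RadiallyUnbounded {n : ℕ} {Γ : Type*} (V : Eucl n × Γ → ℝ)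
    (domV domf : Set (Eucl n × Γ)) : Prop :=
  ∃ α₁ α₂ : ℝ → ℝ, ClassKInf α₁ ∧ ClassKInf α₂ ∧
    ∀ γ : Γ, ∀ ξ ∈ Ogamma domV domf γ, α₁ ‖ξ‖ ≤ V (ξ, γ) ∧ V (ξ, γ) ≤ α₂ ‖ξ‖

/-- Simple cycle `{γ_i}_{i=1}^m` of the set-valued map `H`. -/
def IsSimpleCycle {Γ : Type*} (H : Γ → Set Γ) (m : ℕ) (γs : ℕ → Γ) : Prop :=
  3 ≤ m ∧ γs 1 = γs m ∧ (∀ i, 1 ≤ i → i < m → γs (i + 1) ∈ H (γs i)) ∧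
  ∀ i j, 1 ≤ i → i < j → j ≤ m → γs i = γs j → i = 1 ∧ j = m

/-- A family of forward complete trajectories of the switched system. -/
def ForwardCompleteFamily {n : ℕ} {Γ : Type*} [TopologicalSpace Γ]
    (f : Eucl n × Γ → Eucl n) (domf : Set (Eucl n × Γ))
    (T : Set ((ℝ → Eucl n) × (ℝ → Γ))) : Prop :=
  ∀ xs ∈ T, ∃ I : Set ℝ, Set.Ici (0 : ℝ) ⊆ I ∧ IsTrajectory f domf xs.1 xs.2 I

/-- Condition (a) : `O_γ^f(f_γ,W_γ,∞) ∩ O_γ^b(f_γ,W_γ,∞) ⊆ {0}` for every `γ`. -/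
def CondA {n : ℕ} {Γ : Type*} (f : Eucl n × Γ → Eucl n)
    (domf domV : Set (Eucl n × Γ)) (W : Eucl n × Γ → ℝ) : Prop :=
  ∀ γ : Γ, XFwdInf (Ogamma domV domf γ) (fun ξ => f (ξ, γ)) (fun ξ => W (ξ, γ)) ∩
    XBwdInf (Ogamma domV domf γ) (fun ξ => f (ξ, γ)) (fun ξ => W (ξ, γ)) ⊆ {0}

/-- Condition (b) : `O_γ^b(f_γ,W_γ) ∩ O_{γ'}^f(f_{γ'},W_{γ'}) ⊆ {0}` for `γ ≠ γ'`. -/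
def CondB {n : ℕ} {Γ : Type*} (f : Eucl n × Γ → Eucl n)
    (domf domV : Set (Eucl n × Γ)) (W : Eucl n × Γ → ℝ) : Prop :=
  ∀ γ γ' : Γ, γ ≠ γ' →
    XBwdFin (Ogamma domV domf γ) (fun ξ => f (ξ, γ)) (fun ξ => W (ξ, γ)) ∩
    XFwdFin (Ogamma domV domf γ') (fun ξ => f (ξ, γ')) (fun ξ => W (ξ, γ')) ⊆ {0}

/-- Condition (b') : the variant of (b) involving the level sets of `V`. -/
def CondB' {n : ℕ} {Γ : Type*} (f : Eucl n × Γ → Eucl n) (V : Eucl n × Γ → ℝ)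
    (domf domV : Set (Eucl n × Γ)) (W : Eucl n × Γ → ℝ) : Prop :=
  ∀ γ γ' : Γ, γ ≠ γ' → ∀ c : ℝ,
    XBwdFin (Ogamma domV domf γ) (fun ξ => f (ξ, γ)) (fun ξ => W (ξ, γ)) ∩
    XFwdFin (Ogamma domV domf γ') (fun ξ => f (ξ, γ')) (fun ξ => W (ξ, γ')) ∩
    {ξ : Eucl n | V (ξ, γ) = c} ∩ {ξ : Eucl n | V (ξ, γ') = c} ⊆ {0}

/-- Condition (i) of the cycle theorems :
either all the forward infinite-horizon sets, or all the backward ones, reduce to `{0}`. -/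
def CondI {n : ℕ} {Γ : Type*} (f : Eucl n × Γ → Eucl n)
    (domf domV : Set (Eucl n × Γ)) (W : Eucl n × Γ → ℝ) : Prop :=
  (∀ γ : Γ, XFwdInf (Ogamma domV domf γ) (fun ξ => f (ξ, γ)) (fun ξ => W (ξ, γ)) ⊆ {0}) ∨
  (∀ γ : Γ, XBwdInf (Ogamma domV domf γ) (fun ξ => f (ξ, γ)) (fun ξ => W (ξ, γ)) ⊆ {0})

/-- Condition (ii) on simple cycles of `H`. -/
def CondCycle {n : ℕ} {Γ : Type*} (f : Eucl n × Γ → Eucl n)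
    (domf domV : Set (Eucl n × Γ)) (W : Eucl n × Γ → ℝ) (H : Γ → Set Γ) : Prop :=
  ∀ m : ℕ, ∀ γs : ℕ → Γ, IsSimpleCycle H m γs →
    ∃ j : ℕ, 1 ≤ j ∧ j < m ∧
      XBwdFin (Ogamma domV domf (γs j)) (fun ξ => f (ξ, γs j)) (fun ξ => W (ξ, γs j)) ∩
      XFwdFin (Ogamma domV domf (γs (j + 1))) (fun ξ => f (ξ, γs (j + 1)))
        (fun ξ => W (ξ, γs (j + 1))) ⊆ {0}

/-- Condition (iii) on simple cycles of `H`, involving the level sets of `V`. -/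
def CondCycle' {n : ℕ} {Γ : Type*} (f : Eucl n × Γ → Eucl n) (V : Eucl n × Γ → ℝ)
    (domf domV : Set (Eucl n × Γ)) (W : Eucl n × Γ → ℝ) (H : Γ → Set Γ) : Prop :=
  ∀ c : ℝ, ∀ m : ℕ, ∀ γs : ℕ → Γ, IsSimpleCycle H m γs →
    ∃ j : ℕ, 1 ≤ j ∧ j < m ∧
      XBwdFin (Ogamma domV domf (γs j)) (fun ξ => f (ξ, γs j)) (fun ξ => W (ξ, γs j)) ∩
      XFwdFin (Ogamma domV domf (γs (j + 1))) (fun ξ => f (ξ, γs (j + 1)))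
        (fun ξ => W (ξ, γs (j + 1))) ∩
      {ξ : Eucl n | V (ξ, γs j) = c} ∩ {ξ : Eucl n | V (ξ, γs (j + 1)) = c} ⊆ {0}

/-- For every `γ`, `O_γ^b(f_γ,W_γ) = E_γ ∩ O_γ` or `O_γ^f(f_γ,W_γ) = E_γ ∩ O_γ`. -/
def CondEquilObs {n : ℕ} {Γ : Type*} (f : Eucl n × Γ → Eucl n)
    (domf domV : Set (Eucl n × Γ)) (W : Eucl n × Γ → ℝ) : Prop :=
  ∀ γ : Γ,
    XBwdFin (Ogamma domV domf γ) (fun ξ => f (ξ, γ)) (fun ξ => W (ξ, γ)) =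
      Egamma f domf γ ∩ Ogamma domV domf γ ∨
    XFwdFin (Ogamma domV domf γ) (fun ξ => f (ξ, γ)) (fun ξ => W (ξ, γ)) =
      Egamma f domf γ ∩ Ogamma domV domf γ

end


section Signals

lemma jump_dist {Γ : Type*} [TopologicalSpace Γ] {σ : ℝ → Γ} {τD : ℝ} (hτ : 0 < τD)
    (hσ : σ ∈ SD Γ τD) {t₁ t₂ : ℝ} (h1 : t₁ ∈ JumpTimes σ) (h2 : t₂ ∈ JumpTimes σ)
    (h12 : t₁ < t₂) : τD ≤ t₂ - t₁ := by
  obtain ⟨hs, hd⟩ := hσ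
  refine le_of_forall_pos_le_add fun ε hε => ?_
  have h := hd (t₁ - ε / 2) (t₂ + ε / 2) (by linarith)
  have hfin : (JumpTimes σ ∩ Set.Ioo (t₁ - ε / 2) (t₂ + ε / 2)).Finite :=
    (hs.locFinite (t₁ - ε / 2) (t₂ + ε / 2)).subset
      (Set.inter_subset_inter_right _ Set.Ioo_subset_Icc_self)
  have hsub : ({t₁, t₂} : Set ℝ) ⊆ JumpTimes σ ∩ Set.Ioo (t₁ - ε / 2) (t₂ + ε / 2) := by
    rintro t (rfl | rfl)
    · exact ⟨h1, by constructor <;> linarith⟩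
    · exact ⟨h2, by constructor <;> linarith⟩
  have hc := Set.ncard_le_ncard hsub hfin
  rw [Set.ncard_pair h12.ne] at hc
  have hc' : (2 : ℝ) ≤ ((JumpTimes σ ∩ Set.Ioo (t₁ - ε / 2) (t₂ + ε / 2)).ncard : ℝ) := by
    exact_mod_cast hc
  have h3 : (1 : ℝ) ≤ (t₂ + ε / 2 - (t₁ - ε / 2)) / τD := by
    push_cast at h; linarith
  rw [le_div_iff₀ hτ] at h3
  linarith

lemma exists_jump {Γ : Type*} [TopologicalSpace Γ] [DiscreteTopology Γ] {σ : ℝ → Γ}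
    (hs : IsSwitchingSignal σ) {a b : ℝ} (hab : a ≤ b) (hne : σ a ≠ σ b) :
    ∃ t ∈ JumpTimes σ, a < t ∧ t ≤ b := by
  by_contra! hno
  apply hne
  have hcont : ContinuousOn σ (Set.Icc a b) := by
    intro t ht
    rcases eq_or_lt_of_le ht.1 with h | h
    · subst h
      obtain ⟨ε, hε, hc⟩ := hs.rightConst a
      have hev : ∀ᶠ s in nhdsWithin a (Set.Icc a b), σ s = σ a := by
        have h1 : ∀ᶠ s in nhdsWithin a (Set.Icc a b), s < a + ε :=
          nhdsWithin_le_nhds (Iio_mem_nhds (by linarith))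
        filter_upwards [h1, self_mem_nhdsWithin] with s hs1 hs2
        exact hc s ⟨hs2.1, hs1⟩
      exact (tendsto_const_nhds).congr' (hev.mono fun s hs => hs.symm)
    · have : ContinuousAt σ t := by
        by_contra hj
        exact absurd ht.2 (not_le.2 (hno t hj h))
      exact this.continuousWithinAt
  exact isPreconnected_Icc.constant hcont (Set.left_mem_Icc.2 hab) (Set.right_mem_Icc.2 hab)

lemma signal_D {Γ : Type*} [TopologicalSpace Γ] [DiscreteTopology Γ] {σ : ℝ → Γ} {τD : ℝ}
    (hτ : 0 < τD) (hσ : σ ∈ SD Γ τD) {a b c : ℝ} (hab : a ≤ b) (hbc : b ≤ c) (hac : c - a < τD) :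
    σ a = σ b ∨ σ b = σ c := by
  by_contra! hno
  obtain ⟨t1, h1, h1a, h1b⟩ := exists_jump hσ.1 hab hno.1
  obtain ⟨t2, h2, h2a, h2b⟩ := exists_jump hσ.1 hbc hno.2
  have := jump_dist hτ hσ h1 h2 (by linarith)
  linarith

lemma signal_H {Γ : Type*} [TopologicalSpace Γ] [DiscreteTopology Γ] {σ : ℝ → Γ} {τD : ℝ}
    (hτ : 0 < τD) (hσ : σ ∈ SD Γ τD) {H : Γ → Set Γ} (hH : σ ∈ SH H) {a b : ℝ}
    (hab : a ≤ b) (hac : b - a < τD) : σ a = σ b ∨ σ b ∈ H (σ a) := by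
  by_cases hne : σ a = σ b
  · exact Or.inl hne
  right
  obtain ⟨t, ht, hta, htb⟩ := exists_jump hσ.1 hab hne
  have hb : σ t = σ b := by
    by_contra h
    obtain ⟨t2, h2, h2a, h2b⟩ := exists_jump hσ.1 htb h
    have := jump_dist hτ hσ ht h2 (by linarith)
    linarith
  rw [← hb]
  apply hH t ht
  have hev : ∀ᶠ s in nhdsWithin t (Set.Iio t), σ s = σ a := by
    have h1 : ∀ᶠ s in nhdsWithin t (Set.Iio t), a < s :=
      nhdsWithin_le_nhds (Ioi_mem_nhds hta)
    filter_upwards [h1, self_mem_nhdsWithin] with s hs1 hs2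
    by_contra h
    obtain ⟨t2, h2, h2a, h2b⟩ := exists_jump hσ.1 hs1.le (Ne.symm h)
    have h3 : t2 < t := lt_of_le_of_lt h2b hs2
    have := jump_dist hτ hσ h2 ht h3
    linarith
  exact (tendsto_const_nhds).congr' (hev.mono fun s hs => hs.symm)

end Signals

section Cycles

lemma walk_of_transGen {Γ : Type*} {R : Γ → Γ → Prop} {a b : Γ} (h : Relation.TransGen R a b) :
    ∃ m : ℕ, 2 ≤ m ∧ ∃ γs : ℕ → Γ, γs 1 = a ∧ γs m = b ∧
      ∀ i, 1 ≤ i → i < m → R (γs i) (γs (i + 1)) := by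
  induction h with
  | single hab =>
    rename_i b
    refine ⟨2, le_rfl, fun i => if i ≤ 1 then a else b, by simp, by simp, ?_⟩
    intro i h1 h2
    have : i = 1 := by omega
    subst this
    simpa using hab
  | tail hab hbc ih =>
    rename_i b c
    obtain ⟨m, hm, γs, h1, h2, h3⟩ := ih
    refine ⟨m + 1, by omega, fun i => if i ≤ m then γs i else c, ?_, by simp, ?_⟩
    · simp [show 1 ≤ m by omega, h1]
    · intro i hi1 hi2
      rcases Nat.lt_or_ge i m with h | h
      · simpa [show i ≤ m by omega, show i + 1 ≤ m by omega] using h3 i hi1 h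
      · have : i = m := by omega
        subst this
        simpa [h2] using hbc

lemma simpleCycle_of_transGen {Γ : Type*} {R : Γ → Γ → Prop} {H : Γ → Set Γ}
    (hirr : ∀ γ, ¬ R γ γ) (hRH : ∀ a b, R a b → b ∈ H a) {a : Γ} (h : Relation.TransGen R a a) :
    ∃ (m : ℕ) (γs : ℕ → Γ), IsSimpleCycle H m γs ∧ ∀ i, 1 ≤ i → i < m → R (γs i) (γs (i + 1)) := by
  classical
  let P : ℕ → Prop := fun m => 2 ≤ m ∧ ∃ γs : ℕ → Γ, γs 1 = γs m ∧
      ∀ i, 1 ≤ i → i < m → R (γs i) (γs (i + 1))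
  have hP : ∃ m, P m := by
    obtain ⟨m, hm, γs, h1, h2, h3⟩ := walk_of_transGen h
    exact ⟨m, hm, γs, h1.trans h2.symm, h3⟩
  obtain ⟨hm, γs, h1, h3⟩ := Nat.find_spec hP
  have hmin : ∀ k, k < Nat.find hP → ¬ P k := fun k hk => Nat.find_min hP hk
  generalize Nat.find hP = m at *
  refine ⟨m, γs, ⟨?_, h1, fun i hi hi' => hRH _ _ (h3 i hi hi'), ?_⟩, h3⟩
  · by_contra hlt
    have : m = 2 := by omega
    subst this
    have := h3 1 le_rfl (by norm_num)
    norm_num at this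
    rw [← h1] at this
    exact hirr _ this
  · intro i j hi hij hj heq
    by_contra hno
    apply hmin (j - i + 1) (by omega)
    refine ⟨by omega, fun k => γs (k + i - 1), ?_, ?_⟩
    · simp only []
      rw [show 1 + i - 1 = i by omega, show j - i + 1 + i - 1 = j by omega, heq]
    · intro k hk hk'
      have := h3 (k + i - 1) (by omega) (by omega)
      simpa [show k + 1 + i - 1 = k + i - 1 + 1 by omega] using this

lemma transGen_of_seq {Γ : Type*} [Finite Γ] {R : Γ → Γ → Prop} (g : ℕ → Γ)
    (hg : ∀ k, g k = g (k + 1) ∨ R (g k) (g (k + 1)))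
    (hinf : ∀ K, ∃ k ≥ K, g k ≠ g (k + 1)) : ∃ a, Relation.TransGen R a a := by
  have hrt : ∀ k d, Relation.ReflTransGen R (g k) (g (k + d)) := by
    intro k d
    induction d with
    | zero => exact Relation.ReflTransGen.refl
    | succ d ih =>
      rcases hg (k + d) with h | h
      · rw [← add_assoc, ← h]; exact ih
      · exact ih.tail h
  have hrt' : ∀ k l, k ≤ l → Relation.ReflTransGen R (g k) (g l) := by
    intro k l hkl
    obtain ⟨d, rfl⟩ := Nat.exists_eq_add_of_le hkl
    exact hrt k d
  obtain ⟨γ, hγ⟩ := Finite.exists_infinite_fiber g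
  have hγ' : (g ⁻¹' {γ}).Infinite := Set.infinite_coe_iff.1 hγ
  obtain ⟨k, hk, -⟩ := hγ'.exists_gt 0
  obtain ⟨k', hk', hne⟩ := hinf k
  obtain ⟨l, hl, hl'⟩ := hγ'.exists_gt k'
  refine ⟨γ, ?_⟩
  have hk : g k = γ := hk
  have hl : g l = γ := hl
  have h1 := hrt' k k' hk'
  have h2 : R (g k') (g (k' + 1)) := (hg k').resolve_left hne
  have h3 := hrt' (k' + 1) l hl'
  rw [hk] at h1
  rw [hl] at h3
  exact (Relation.TransGen.tail' h1 h2).trans_left h3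

end Cycles
section Limits

/-- Properties of the limiting objects obtained from a trajectory along an ultrafilter. -/
structure LimTraj {n : ℕ} {Γ : Type*} (f : Eucl n × Γ → Eucl n)
    (domf : Set (Eucl n × Γ)) (V : Eucl n × Γ → ℝ) (domV : Set (Eucl n × Γ))
    (H : Γ → Set Γ) (τD : ℝ) (c : Γ → ℝ) (φ : ℝ → Eucl n) (sg : ℝ → Γ) : Prop where
  cont : Continuous φ
  memO : ∀ s, φ s ∈ Oset domV
  dom : ∀ s, (φ s, sg s) ∈ domf
  D : ∀ a b d, a ≤ b → b ≤ d → d - a < τD → sg a = sg b ∨ sg b = sg d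
  Hp : ∀ a b, a ≤ b → b - a < τD → sg a = sg b ∨ sg b ∈ H (sg a)
  est : ∀ γ, ∀ ε > (0 : ℝ), ∃ δ > (0 : ℝ), ∀ u v, |v - u| < δ → sg u = γ → sg v = γ →
    ‖φ v - φ u - (v - u) • f (φ u, γ)‖ ≤ ε * |v - u|
  Vc : ∀ s, V (φ s, sg s) = c (sg s)

lemma IsSolOn.mono' {n : ℕ} {g : Eucl n → Eucl n} {X X' : Set (Eucl n)} {φ : ℝ → Eucl n}
    {I I' : Set ℝ} (h : IsSolOn g X φ I) (hI : I' ⊆ I) (hX : X ⊆ X') : IsSolOn g X' φ I' :=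
  ⟨h.1.mono hI, fun t ht => hX (h.2.1 t (hI ht)),
    fun t₀ h0 t ht => h.2.2 t₀ (hI h0) t (hI ht)⟩

lemma IsSolOn.shift {n : ℕ} {g : Eucl n → Eucl n} {X : Set (Eucl n)} {φ : ℝ → Eucl n}
    {I I' : Set ℝ} (h : IsSolOn g X φ I) (r : ℝ) (hI : ∀ t ∈ I', t + r ∈ I) :
    IsSolOn g X (fun t => φ (t + r)) I' := by
  refine ⟨h.1.comp (by fun_prop) hI, fun t ht => h.2.1 _ (hI t ht), fun t₀ h0 t ht => ?_⟩
  obtain ⟨h1, h2⟩ := h.2.2 _ (hI t₀ h0) _ (hI t ht)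
  constructor
  · have := h1.comp_add_right r
    simpa using this
  · rw [intervalIntegral.integral_comp_add_right (fun s => g (φ s)) r]
    exact h2

variable {n : ℕ} {Γ : Type*} [TopologicalSpace Γ] {f : Eucl n × Γ → Eucl n}
    {domf : Set (Eucl n × Γ)} {V : Eucl n × Γ → ℝ} {domV : Set (Eucl n × Γ)}
    {W : Eucl n × Γ → ℝ} {H : Γ → Set Γ} {τD : ℝ} {c : Γ → ℝ} {φ : ℝ → Eucl n} {sg : ℝ → Γ}

lemma LimTraj.hasDerivAt (h : LimTraj f domf V domV H τD c φ sg) {a b : ℝ} {γ : Γ}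
    (hs : ∀ s ∈ Ioo a b, sg s = γ) {s : ℝ} (hsab : s ∈ Ioo a b) :
    HasDerivAt φ (f (φ s, γ)) s := by
  rw [hasDerivAt_iff_isLittleO, Asymptotics.isLittleO_iff]
  intro ε hε
  obtain ⟨δ, hδ, hest⟩ := h.est γ ε hε
  filter_upwards [Ioo_mem_nhds hsab.1 hsab.2, Metric.ball_mem_nhds s hδ] with v hv hv'
  exact hest s v (by simpa [Real.dist_eq] using hv') (hs s hsab) (hs v hv)

lemma LimTraj.seg (h : LimTraj f domf V domV H τD c φ sg)
    (hdomf : IsClosed domf) (hf : ContinuousOn f domf) (hV : ClassVFun V domV domf)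
    (hW : Wineq f V W domV domf) {a b : ℝ} {γ : Γ} (hab : a < b)
    (hs : ∀ s ∈ Ioo a b, sg s = γ) :
    IsSolOn (fun ξ => f (ξ, γ)) (Ogamma domV domf γ) φ (Icc a b) ∧
      ∀ s ∈ Icc a b, W (φ s, γ) = 0 ∧ V (φ s, γ) = c γ := by
  have hdom : ∀ s ∈ Icc a b, (φ s, γ) ∈ domf := by
    have hcl : IsClosed {s | (φ s, γ) ∈ domf} :=
      hdomf.preimage (h.cont.prodMk continuous_const)
    have hsub : Ioo a b ⊆ {s | (φ s, γ) ∈ domf} := by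
      intro s hsab
      have := h.dom s
      rw [hs s hsab] at this
      exact this
    rw [← closure_Ioo hab.ne]
    exact hcl.closure_subset_iff.2 hsub
  have hO : ∀ s ∈ Icc a b, φ s ∈ Ogamma domV domf γ := fun s hsab => ⟨h.memO s, hdom s hsab⟩
  have hVc : ∀ s ∈ Icc a b, V (φ s, γ) = c γ := by
    have hcont : ContinuousOn (fun s => V (φ s, γ)) (Icc a b) := by
      intro s hsab
      have h1 := (hV.diff γ _ (hO s hsab)).continuousAt
      exact (ContinuousAt.comp (f := φ) (g := fun ξ => V (ξ, γ)) h1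
        h.cont.continuousAt).continuousWithinAt
    have heq : EqOn (fun s => V (φ s, γ)) (fun _ => c γ) (Ioo a b) := by
      intro s hsab
      have := h.Vc s
      rw [hs s hsab] at this
      exact this
    exact heq.of_subset_closure hcont continuousOn_const Ioo_subset_Icc_self
      (by rw [closure_Ioo hab.ne])
  have hG : ContinuousOn (fun s => f (φ s, γ)) (Icc a b) :=
    hf.comp (h.cont.prodMk continuous_const).continuousOn hdom
  have hint : ∀ u ∈ Icc a b, ∀ v ∈ Icc a b,
      IntervalIntegrable (fun s => f (φ s, γ)) volume u v := by
    intro u hu v hv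
    exact (hG.mono (ordConnected_Icc.uIcc_subset hu hv)).intervalIntegrable
  have hle : ∀ u ∈ Icc a b, ∀ v ∈ Icc a b, u ≤ v → φ v = φ u + ∫ s in u..v, f (φ s, γ) := by
    intro u hu v hv huv
    rw [intervalIntegral.integral_eq_sub_of_hasDerivAt_of_le huv h.cont.continuousOn
      (fun s hsuv => h.hasDerivAt hs ⟨lt_of_le_of_lt hu.1 hsuv.1, lt_of_lt_of_le hsuv.2 hv.2⟩)
      (hint u hu v hv)]
    abel
  refine ⟨⟨h.cont.continuousOn, hO, fun u hu v hv => ⟨hint u hu v hv, ?_⟩⟩, fun s hsab => ⟨?_, hVc s hsab⟩⟩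
  · rcases le_total u v with huv | huv
    · exact hle u hu v hv huv
    · rw [intervalIntegral.integral_symm, hle v hv u hu huv]
      abel
  · have ha : a ∈ Icc a b := left_mem_Icc.2 hab.le
    have : Fact (s ∈ Icc a b) := ⟨hsab⟩
    have hd0 : HasDerivWithinAt (fun u => ∫ r in a..u, f (φ r, γ)) (f (φ s, γ)) (Icc a b) s :=
      intervalIntegral.integral_hasDerivWithinAt_right (hint a ha s hsab)
        (hG.stronglyMeasurableAtFilter_nhdsWithin measurableSet_Icc s) (hG s hsab)
    have hd : HasDerivWithinAt φ (f (φ s, γ)) (Icc a b) s :=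
      (hd0.const_add (φ a)).congr (fun u hu => hle a ha u hu hu.1) (hle a ha s hsab hsab.1)
    have hd1 := (hV.diff γ _ (hO s hsab)).hasFDerivAt.comp_hasDerivWithinAt s hd
    have hd2 : HasDerivWithinAt ((fun ξ' => V (ξ', γ)) ∘ φ) 0 (Icc a b) s :=
      (hasDerivWithinAt_const s (Icc a b) (c γ)).congr (fun u hu => hVc u hu) (hVc s hsab)
    have h0 := (uniqueDiffOn_Icc hab s hsab).eq_deriv _ hd1 hd2
    obtain ⟨hw1, hw2⟩ := hW γ _ (hO s hsab)
    rw [h0] at hw1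
    linarith

lemma LimTraj.const_between (h : LimTraj f domf V domV H τD c φ sg) {u v r : ℝ} {γ : Γ}
    (hu : sg u = γ) (hv : sg v = γ) (hd : v - u < τD) (h1 : u ≤ r) (h2 : r ≤ v) : sg r = γ := by
  rcases h.D u r v h1 h2 hd with h' | h'
  · rw [← h', hu]
  · rw [h', hv]

lemma LimTraj.loc_right (h : LimTraj f domf V domV H τD c φ sg) (hτ : 0 < τD) (s : ℝ) :
    ∃ b > s, ∃ γ, ∀ r ∈ Ioo s b, sg r = γ := by
  by_cases hc : ∀ p ∈ Ioo s (s + τD), ∀ q ∈ Ioo s (s + τD), p < q → sg p = sg q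
  · refine ⟨s + τD / 2, by linarith, sg (s + τD / 2), fun r hr => hc r ?_ _ ?_ hr.2⟩
    · exact ⟨hr.1, by linarith [hr.2]⟩
    · constructor <;> linarith
  · push Not at hc
    obtain ⟨p, hp, q, hq, hpq, hne⟩ := hc
    refine ⟨p, hp.1, sg p, fun r hr => ?_⟩
    exact (h.D r p q hr.2.le hpq.le (by linarith [hr.1, hq.2])).resolve_right hne

lemma LimTraj.loc_left (h : LimTraj f domf V domV H τD c φ sg) (hτ : 0 < τD) (s : ℝ) :
    ∃ b < s, ∃ γ, ∀ r ∈ Ioo b s, sg r = γ := by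
  by_cases hc : ∀ p ∈ Ioo (s - τD) s, ∀ q ∈ Ioo (s - τD) s, p < q → sg p = sg q
  · refine ⟨s - τD / 2, by linarith, sg (s - τD / 2), fun r hr => (hc _ ?_ _ ?_ hr.1).symm⟩
    · constructor <;> linarith
    · exact ⟨by linarith [hr.1], hr.2⟩
  · push Not at hc
    obtain ⟨p, hp, q, hq, hpq, hne⟩ := hc
    refine ⟨q, hq.2, sg q, fun r hr => ?_⟩
    exact ((h.D p q r hpq.le hr.1.le (by linarith [hr.2, hp.1])).resolve_left hne).symm

lemma LimTraj.zero_seg (h : LimTraj f domf V domV H τD c φ sg)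
    (hdomf : IsClosed domf) (hf : ContinuousOn f domf) (hV : ClassVFun V domV domf)
    (hW : Wineq f V W domV domf) (hE0 : AssumpE0 f domf) (hU : AssumpU f domf)
    {a b : ℝ} {γ : Γ} (hab : a < b)
    (hs : ∀ s ∈ Ioo a b, sg s = γ) {r : ℝ} (hr : r ∈ Icc a b) (hr0 : φ r = 0) :
    ∀ s ∈ Icc a b, φ s = 0 := by
  intro s hsab
  have hsol := (h.seg hdomf hf hV hW hab hs).1
  have h0 : ((0 : Eucl n), γ) ∈ domf := by
    have := (hsol.2.1 r hr).2
    rwa [hr0] at this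
  have hsol1 : IsSolOn (fun ξ => f (ξ, γ)) {ξ | (ξ, γ) ∈ domf} (fun t => φ (t + r))
      (Icc (a - r) (b - r)) :=
    (hsol.mono' subset_rfl (fun ξ hξ => hξ.2)).shift r
      (fun t ht => ⟨by linarith [ht.1], by linarith [ht.2]⟩)
  have hsol2 : IsSolOn (fun ξ => f (ξ, γ)) {ξ | (ξ, γ) ∈ domf} (fun _ => (0 : Eucl n))
      (Icc (a - r) (b - r)) := by
    refine ⟨continuousOn_const, fun _ _ => h0, fun t₀ _ t _ => ?_⟩
    simp [hE0 γ h0]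
  have := hU γ h0 _ ordConnected_Icc ⟨by linarith [hr.1], by linarith [hr.2]⟩ _ _ hsol1 hsol2
    (by simpa using hr0) rfl (s - r) ⟨by linarith [hsab.1], by linarith [hsab.2]⟩
  simpa using this

lemma LimTraj.zero_all (h : LimTraj f domf V domV H τD c φ sg) (hτ : 0 < τD)
    (hdomf : IsClosed domf) (hf : ContinuousOn f domf) (hV : ClassVFun V domV domf)
    (hW : Wineq f V W domV domf) (hE0 : AssumpE0 f domf) (hU : AssumpU f domf)
    {r : ℝ} (hr0 : φ r = 0) (s : ℝ) : φ s = 0 := by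
  have hclosed : IsClosed {s | φ s = 0} := isClosed_eq h.cont continuous_const
  have hopen : IsOpen {s | φ s = 0} := by
    rw [isOpen_iff_mem_nhds]
    intro s hs
    obtain ⟨b, hb, γ, hγ⟩ := h.loc_right hτ s
    obtain ⟨a, ha, γ', hγ'⟩ := h.loc_left hτ s
    have h1 := h.zero_seg hdomf hf hV hW hE0 hU hb hγ (left_mem_Icc.2 hb.le) hs
    have h2 := h.zero_seg hdomf hf hV hW hE0 hU ha hγ' (right_mem_Icc.2 ha.le) hs
    filter_upwards [Ioo_mem_nhds ha hb] with t ht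
    rcases le_total t s with hts | hts
    · exact h2 t ⟨ht.1.le, hts⟩
    · exact h1 t ⟨hts, ht.2.le⟩
  have huniv := IsClopen.eq_univ ⟨hclosed, hopen⟩ ⟨r, hr0⟩
  have : s ∈ {s | φ s = 0} := by rw [huniv]; trivial
  exact this

lemma LimTraj.jump (h : LimTraj f domf V domV H τD c φ sg) (hτ : 0 < τD)
    (hdomf : IsClosed domf) (hf : ContinuousOn f domf) (hV : ClassVFun V domV domf)
    (hW : Wineq f V W domV domf) {s₁ s₂ : ℝ} (h12 : s₁ ≤ s₂) (hd : s₂ - s₁ ≤ τD / 4)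
    (hne : sg s₁ ≠ sg s₂) :
    ∃ t, φ t ∈ XBwdFin (Ogamma domV domf (sg s₁)) (fun ξ => f (ξ, sg s₁))
        (fun ξ => W (ξ, sg s₁)) ∧
      φ t ∈ XFwdFin (Ogamma domV domf (sg s₂)) (fun ξ => f (ξ, sg s₂))
        (fun ξ => W (ξ, sg s₂)) ∧
      V (φ t, sg s₁) = c (sg s₁) ∧ V (φ t, sg s₂) = c (sg s₂) := by
  have hl : sg (s₁ - τD / 4) = sg s₁ :=
    (h.D (s₁ - τD / 4) s₁ s₂ (by linarith) h12 (by linarith)).resolve_right hne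
  have hr : sg (s₂ + τD / 4) = sg s₂ :=
    ((h.D s₁ s₂ (s₂ + τD / 4) h12 (by linarith) (by linarith)).resolve_left hne).symm
  set A : Set ℝ := {s | s ∈ Icc s₁ s₂ ∧ sg s = sg s₁} with hA
  have hA1 : s₁ ∈ A := ⟨left_mem_Icc.2 h12, rfl⟩
  have hAb : BddAbove A := ⟨s₂, fun s hs => hs.1.2⟩
  set t := sSup A with ht
  have ht1 : s₁ ≤ t := le_csSup hAb hA1
  have ht2 : t ≤ s₂ := csSup_le ⟨s₁, hA1⟩ fun s hs => hs.1.2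
  have hL : ∀ r ∈ Ioo (s₁ - τD / 4) t, sg r = sg s₁ := by
    intro r hrr
    rcases le_total r s₁ with hr1 | hr1
    · exact h.const_between hl rfl (by linarith) hrr.1.le hr1
    · obtain ⟨a, ha, hra⟩ := exists_lt_of_lt_csSup ⟨s₁, hA1⟩ hrr.2
      exact h.const_between rfl ha.2 (by linarith [ha.1.2]) hr1 hra.le
  have hR : ∀ r ∈ Ioo t (s₂ + τD / 4), sg r = sg s₂ := by
    intro r hrr
    rcases le_total r s₂ with hr1 | hr1
    · have hr0 : s₁ ≤ r := ht1.trans hrr.1.le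
      refine (h.D s₁ r s₂ hr0 hr1 (by linarith)).resolve_left fun heq => ?_
      exact absurd (le_csSup hAb (show r ∈ A from ⟨⟨hr0, hr1⟩, heq.symm⟩)) (not_le.2 hrr.1)
    · exact h.const_between rfl hr (by linarith) hr1 hrr.2.le
  have hlt1 : s₁ - τD / 4 < t := by linarith
  have hlt2 : t < s₂ + τD / 4 := by linarith
  obtain ⟨hS1, hS1'⟩ := h.seg hdomf hf hV hW hlt1 hL
  obtain ⟨hS2, hS2'⟩ := h.seg hdomf hf hV hW hlt2 hR
  refine ⟨t, ?_, ?_, (hS1' t (right_mem_Icc.2 hlt1.le)).2, (hS2' t (left_mem_Icc.2 hlt2.le)).2⟩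
  · refine mem_iUnion₂.2 ⟨t - (s₁ - τD / 4), by simpa using hlt1, fun u => φ (u + t),
      hS1.shift t ?_, by simp, fun u hu => (hS1' _ ?_).1⟩
    · intro u hu; constructor <;> linarith [hu.1, hu.2]
    · constructor <;> linarith [hu.1, hu.2]
  · refine mem_iUnion₂.2 ⟨s₂ + τD / 4 - t, by simpa using hlt2, fun u => φ (u + t),
      hS2.shift t ?_, by simp, fun u hu => (hS2' _ ?_).1⟩
    · intro u hu; constructor <;> linarith [hu.1, hu.2]
    · constructor <;> linarith [hu.1, hu.2]

lemma LimTraj.fwdInf (h : LimTraj f domf V domV H τD c φ sg)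
    (hdomf : IsClosed domf) (hf : ContinuousOn f domf) (hV : ClassVFun V domV domf)
    (hW : Wineq f V W domV domf) {a : ℝ} {γ : Γ} (hs : ∀ s, a ≤ s → sg s = γ) :
    φ a ∈ XFwdInf (Ogamma domV domf γ) (fun ξ => f (ξ, γ)) (fun ξ => W (ξ, γ)) := by
  have hseg := fun b (hb : a < b) => h.seg hdomf hf hV hW hb (γ := γ) (fun s hs' => hs s hs'.1.le)
  have hsol : IsSolOn (fun ξ => f (ξ, γ)) (Ogamma domV domf γ) φ (Ici a) := by
    refine ⟨h.cont.continuousOn, fun t ht => ?_, fun u hu v hv => ?_⟩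
    · have ht : a ≤ t := ht
      exact (hseg (t + 1) (by linarith)).1.2.1 t ⟨ht, by linarith⟩
    · have hu : a ≤ u := hu
      have hv : a ≤ v := hv
      have h1 := le_max_left u v
      have h2 := le_max_right u v
      exact (hseg (max u v + 1) (by linarith)).1.2.2 u ⟨hu, by linarith⟩ v ⟨hv, by linarith⟩
  refine ⟨fun u => φ (u + a), hsol.shift a ?_, by simp, ?_⟩
  · intro t ht
    have ht : 0 ≤ t := ht
    show a ≤ t + a
    linarith
  · intro t ht
    have ht : 0 ≤ t := ht
    exact ((hseg (t + a + 1) (by linarith)).2 (t + a) ⟨by linarith, by linarith⟩).1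

lemma LimTraj.bwdInf (h : LimTraj f domf V domV H τD c φ sg)
    (hdomf : IsClosed domf) (hf : ContinuousOn f domf) (hV : ClassVFun V domV domf)
    (hW : Wineq f V W domV domf) {a : ℝ} {γ : Γ} (hs : ∀ s, s ≤ a → sg s = γ) :
    φ a ∈ XBwdInf (Ogamma domV domf γ) (fun ξ => f (ξ, γ)) (fun ξ => W (ξ, γ)) := by
  have hseg := fun b (hb : b < a) => h.seg hdomf hf hV hW hb (γ := γ) (fun s hs' => hs s hs'.2.le)
  have hsol : IsSolOn (fun ξ => f (ξ, γ)) (Ogamma domV domf γ) φ (Iic a) := by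
    refine ⟨h.cont.continuousOn, fun t ht => ?_, fun u hu v hv => ?_⟩
    · have ht : t ≤ a := ht
      exact (hseg (t - 1) (by linarith)).1.2.1 t ⟨by linarith, ht⟩
    · have hu : u ≤ a := hu
      have hv : v ≤ a := hv
      have h1 := min_le_left u v
      have h2 := min_le_right u v
      exact (hseg (min u v - 1) (by linarith)).1.2.2 u ⟨by linarith, hu⟩ v ⟨by linarith, hv⟩
  refine ⟨fun u => φ (u + a), hsol.shift a ?_, by simp, ?_⟩
  · intro t ht
    have ht : t ≤ 0 := ht
    show t + a ≤ a
    linarith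
  · intro t ht
    have ht : t ≤ 0 := ht
    exact ((hseg (t + a - 1) (by linarith)).2 (t + a) ⟨by linarith, by linarith⟩).1

/-- The admissible-cycle condition at the level family `c`. -/
def CycleAt {n : ℕ} {Γ : Type*} (f : Eucl n × Γ → Eucl n) (V : Eucl n × Γ → ℝ)
    (domf domV : Set (Eucl n × Γ)) (W : Eucl n × Γ → ℝ) (H : Γ → Set Γ) (c : Γ → ℝ) : Prop :=
  ∀ m : ℕ, ∀ γs : ℕ → Γ, IsSimpleCycle H m γs →
    ∃ j : ℕ, 1 ≤ j ∧ j < m ∧ ∀ ξ,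
      ξ ∈ XBwdFin (Ogamma domV domf (γs j)) (fun ξ => f (ξ, γs j)) (fun ξ => W (ξ, γs j)) →
      ξ ∈ XFwdFin (Ogamma domV domf (γs (j + 1))) (fun ξ => f (ξ, γs (j + 1)))
        (fun ξ => W (ξ, γs (j + 1))) →
      V (ξ, γs j) = c (γs j) → V (ξ, γs (j + 1)) = c (γs (j + 1)) → ξ = 0

lemma LimTraj.eq_zero [Finite Γ] (h : LimTraj f domf V domV H τD c φ sg) (hτ : 0 < τD)
    (hdomf : IsClosed domf) (hf : ContinuousOn f domf) (hV : ClassVFun V domV domf)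
    (hW : Wineq f V W domV domf) (hE0 : AssumpE0 f domf) (hU : AssumpU f domf)
    (hI : CondI f domf domV W) (hC : CycleAt f V domf domV W H c) (s : ℝ) : φ s = 0 := by
  by_contra hs0
  have hnz : ∀ r, φ r ≠ 0 := fun r hr => hs0 (h.zero_all hτ hdomf hf hV hW hE0 hU hr s)
  let R : Γ → Γ → Prop := fun γ γ' => γ ≠ γ' ∧ γ' ∈ H γ ∧ ∃ ξ, ξ ≠ 0 ∧
      ξ ∈ XBwdFin (Ogamma domV domf γ) (fun ξ => f (ξ, γ)) (fun ξ => W (ξ, γ)) ∧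
      ξ ∈ XFwdFin (Ogamma domV domf γ') (fun ξ => f (ξ, γ')) (fun ξ => W (ξ, γ')) ∧
      V (ξ, γ) = c γ ∧ V (ξ, γ') = c γ'
  have hstep : ∀ s₁ s₂, s₁ ≤ s₂ → s₂ - s₁ ≤ τD / 4 → sg s₁ = sg s₂ ∨ R (sg s₁) (sg s₂) := by
    intro s₁ s₂ h12 hd
    by_cases hne : sg s₁ = sg s₂
    · exact Or.inl hne
    right
    obtain ⟨t, h1, h2, h3, h4⟩ := h.jump hτ hdomf hf hV hW h12 hd hne
    exact ⟨hne, (h.Hp s₁ s₂ h12 (by linarith)).resolve_left hne, φ t, hnz t, h1, h2, h3, h4⟩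
  have hacyc : ∀ a, ¬ Relation.TransGen R a a := by
    intro a ha
    obtain ⟨m, γs, hsc, hR⟩ := simpleCycle_of_transGen (H := H) (fun γ hγ => hγ.1 rfl)
      (fun _ _ hab => hab.2.1) ha
    obtain ⟨j, hj1, hjm, hj⟩ := hC m γs hsc
    obtain ⟨-, -, ξ, hξ, h1, h2, h3, h4⟩ := hR j hj1 hjm
    exact hξ (hj ξ h1 h2 h3 h4)
  rcases hI with hI | hI
  · obtain ⟨a, ha⟩ := transGen_of_seq (R := R) (fun k : ℕ => sg ((k : ℝ) * (τD / 4)))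
      (fun k => by
        refine hstep _ _ ?_ ?_ <;> push_cast <;> nlinarith)
      (by
        intro K
        by_contra! hcon
        refine hnz _ (hI (sg ((K : ℝ) * (τD / 4))) (h.fwdInf hdomf hf hV hW
          (a := (K : ℝ) * (τD / 4)) ?_))
        have hall : ∀ d : ℕ, sg (((K + d : ℕ) : ℝ) * (τD / 4)) = sg ((K : ℝ) * (τD / 4)) := by
          intro d
          induction d with
          | zero => rfl
          | succ d ih => rw [← ih]; exact (hcon (K + d) (by omega)).symm
        have hall' : ∀ k : ℕ, K ≤ k → sg ((k : ℝ) * (τD / 4)) = sg ((K : ℝ) * (τD / 4)) := by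
          intro k hk
          obtain ⟨d, rfl⟩ := Nat.exists_eq_add_of_le hk
          exact hall d
        intro r hr
        have hr0 : 0 ≤ r / (τD / 4) := by
          apply div_nonneg _ (by linarith)
          refine le_trans ?_ hr
          positivity
        have hp : 0 < τD / 4 := by linarith
        have hf1 := Nat.floor_le hr0
        have hf2 := Nat.lt_floor_add_one (r / (τD / 4))
        have hK : K ≤ ⌊r / (τD / 4)⌋₊ := Nat.le_floor ((le_div_iff₀ hp).2 hr)
        have h1 := hall' _ hK
        have h2 := hall' (⌊r / (τD / 4)⌋₊ + 1) (by omega)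
        rw [le_div_iff₀ hp] at hf1
        rw [div_lt_iff₀ hp] at hf2
        refine h.const_between h1 h2 ?_ hf1 ?_
        · push_cast; nlinarith
        · push_cast; exact hf2.le)
    exact hacyc a ha
  · obtain ⟨a, ha⟩ := transGen_of_seq (R := Function.swap R) (fun k : ℕ => sg (-((k : ℝ) * (τD / 4))))
      (fun k => by
        refine (hstep (-(((k + 1 : ℕ) : ℝ) * (τD / 4))) (-((k : ℝ) * (τD / 4))) ?_ ?_).imp
          Eq.symm id <;> push_cast <;> nlinarith)
      (by
        intro K
        by_contra! hcon
        refine hnz _ (hI (sg (-((K : ℝ) * (τD / 4)))) (h.bwdInf hdomf hf hV hW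
          (a := -((K : ℝ) * (τD / 4))) ?_))
        have hall : ∀ d : ℕ, sg (-(((K + d : ℕ) : ℝ) * (τD / 4))) = sg (-((K : ℝ) * (τD / 4))) := by
          intro d
          induction d with
          | zero => rfl
          | succ d ih => rw [← ih]; exact (hcon (K + d) (by omega)).symm
        have hall' : ∀ k : ℕ, K ≤ k → sg (-((k : ℝ) * (τD / 4))) = sg (-((K : ℝ) * (τD / 4))) := by
          intro k hk
          obtain ⟨d, rfl⟩ := Nat.exists_eq_add_of_le hk
          exact hall d
        intro r hr
        have hr' : (K : ℝ) * (τD / 4) ≤ -r := by linarith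
        have hr0 : 0 ≤ -r / (τD / 4) := by
          apply div_nonneg _ (by linarith)
          refine le_trans ?_ hr'
          positivity
        have hp : 0 < τD / 4 := by linarith
        have hf1 := Nat.floor_le hr0
        have hf2 := Nat.lt_floor_add_one (-r / (τD / 4))
        have hK : K ≤ ⌊-r / (τD / 4)⌋₊ := Nat.le_floor ((le_div_iff₀ hp).2 hr')
        have h1 := hall' _ hK
        have h2 := hall' (⌊-r / (τD / 4)⌋₊ + 1) (by omega)
        rw [le_div_iff₀ hp] at hf1
        rw [div_lt_iff₀ hp] at hf2
        refine h.const_between h2 h1 ?_ ?_ ?_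
        · push_cast; nlinarith
        · push_cast; linarith
        · linarith)
    exact hacyc a (Relation.transGen_swap.1 ha)

end Limits
section Construction

lemma tendsto_of_antitoneOn_bdd {v : ℝ → ℝ} {S : Set ℝ} (hv : AntitoneOn v (S ∩ Ici 0))
    {m : ℝ} (hm : ∀ t ∈ S ∩ Ici 0, m ≤ v t) :
    Tendsto v (atTop ⊓ 𝓟 S) (𝓝 (sInf (v '' (S ∩ Ici 0)))) := by
  have hbdd : BddBelow (v '' (S ∩ Ici 0)) := by
    refine ⟨m, ?_⟩
    rintro _ ⟨t, ht, rfl⟩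
    exact hm t ht
  rw [Metric.tendsto_nhds]
  intro ε hε
  rcases (S ∩ Ici 0).eq_empty_or_nonempty with hemp | hne
  · have h1 : ∀ᶠ t in atTop ⊓ 𝓟 S, t ∈ S ∧ t ∈ Ici (0 : ℝ) :=
      inter_mem (mem_inf_of_right (mem_principal_self S))
        (mem_inf_of_left (Ici_mem_atTop (0 : ℝ)))
    filter_upwards [h1] with t ht
    exact absurd (show t ∈ S ∩ Ici 0 from ht) (by simp [hemp])
  · obtain ⟨_, ⟨t₀, ht₀, rfl⟩, hlt⟩ := exists_lt_of_csInf_lt (hne.image v)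
      (lt_add_of_pos_right (sInf (v '' (S ∩ Ici 0))) hε)
    have h2 : ∀ᶠ t in atTop ⊓ 𝓟 S, t ∈ S := mem_inf_of_right (mem_principal_self S)
    have h3 : ∀ᶠ t in atTop ⊓ 𝓟 S, t₀ ≤ t := mem_inf_of_left (Ici_mem_atTop t₀)
    filter_upwards [h2, h3] with t ht ht'
    have htm : t ∈ S ∩ Ici 0 := ⟨ht, le_trans (show (0 : ℝ) ≤ t₀ from ht₀.2) ht'⟩
    have h4 := csInf_le hbdd (mem_image_of_mem v htm)
    have h5 := hv ht₀ htm ht'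
    rw [Real.dist_eq, abs_lt]
    constructor <;> linarith

variable {n : ℕ} {Γ : Type*} [MetricSpace Γ] [Finite Γ] {f : Eucl n × Γ → Eucl n}
    {domf : Set (Eucl n × Γ)} {V : Eucl n × Γ → ℝ} {domV : Set (Eucl n × Γ)}
    {H : Γ → Set Γ} {τD : ℝ} {c : Γ → ℝ} {x : ℝ → Eucl n} {σ : ℝ → Γ}

lemma isCompact_K (hdomf : IsClosed domf) {B : Set (Eucl n)} (hB : IsCompact B) :
    IsCompact (domf ∩ B ×ˢ (univ : Set Γ)) :=
  (hB.prod finite_univ.isCompact).inter_left hdomf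

lemma V_bddBelow (hdomf : IsClosed domf) (hV : ClassVFun V domV domf) {B : Set (Eucl n)}
    (hB : IsCompact B) (hBO : B ⊆ Oset domV) (γ : Γ) :
    ∃ m, ∀ ξ ∈ B, (ξ, γ) ∈ domf → m ≤ V (ξ, γ) := by
  have hc : IsCompact (B ∩ {ξ | (ξ, γ) ∈ domf}) :=
    hB.inter_right (hdomf.preimage (by fun_prop))
  have hcont : ContinuousOn (fun ξ => V (ξ, γ)) (B ∩ {ξ | (ξ, γ) ∈ domf}) :=
    fun ξ hξ => (hV.diff γ ξ ⟨hBO hξ.1, hξ.2⟩).continuousAt.continuousWithinAt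
  obtain ⟨m, hm⟩ := hc.bddBelow_image hcont
  exact ⟨m, fun ξ h1 h2 => hm ⟨ξ, ⟨h1, h2⟩, rfl⟩⟩

lemma exists_limTraj {Ix : Set ℝ} (hdomf : IsClosed domf) (hf : ContinuousOn f domf)
    (htraj : IsTrajectory f domf x σ Ix) (hfc : Ici (0 : ℝ) ⊆ Ix) (hτ : 0 < τD)
    (hσ : σ ∈ SD Γ τD) (hH : σ ∈ SH H) (hV : ClassVFun V domV domf)
    (hpre : PrecompactRel x Ix (Oset domV))
    (hc : ∀ γ, Tendsto (fun t => V (x t, γ)) (atTop ⊓ 𝓟 {t | σ t = γ}) (𝓝 (c γ)))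
    (U : Ultrafilter ℝ) (hU : (U : Filter ℝ) ≤ atTop) :
    ∃ φ sg, LimTraj f domf V domV H τD c φ sg ∧ Tendsto x U (𝓝 (φ 0)) := by
  obtain ⟨B, hBO, hB, hxB⟩ := hpre
  have hK := isCompact_K (Γ := Γ) hdomf hB
  have hfK : ContinuousOn f (domf ∩ B ×ˢ (univ : Set Γ)) := hf.mono inter_subset_left
  obtain ⟨L, hL⟩ := hK.exists_bound_of_continuousOn hfK
  have hxK : ∀ t, 0 ≤ t → (x t, σ t) ∈ domf ∩ B ×ˢ (univ : Set Γ) := fun t ht =>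
    ⟨htraj.mem t (hfc ht), hxB t (hfc ht), mem_univ _⟩
  have hL0 : 0 ≤ L := (norm_nonneg _).trans (hL _ (hxK 0 le_rfl))
  have hlip : ∀ u v, 0 ≤ u → 0 ≤ v → ‖x v - x u‖ ≤ L * |v - u| := by
    intro u v hu hv
    rw [(htraj.intg u (hfc hu) v (hfc hv)).2, add_sub_cancel_left]
    refine intervalIntegral.norm_integral_le_of_norm_le_const fun s hs => hL _ (hxK s ?_)
    exact (le_min hu hv).trans hs.1.le
  have hev : ∀ s : ℝ, ∀ᶠ t in (U : Filter ℝ), 0 ≤ t + s := fun s => by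
    filter_upwards [hU (Ici_mem_atTop (-s))] with t ht
    have : -s ≤ t := ht
    linarith
  have hφ : ∀ s : ℝ, ∃ ξ ∈ B, Tendsto (fun t => x (t + s)) U (𝓝 ξ) := by
    intro s
    obtain ⟨ξ, h1, h2⟩ := hB.ultrafilter_le_nhds (U.map fun t => x (t + s)) (by
      rw [le_principal_iff]
      exact (hev s).mono fun t ht => hxB _ (hfc ht))
    exact ⟨ξ, h1, h2⟩
  choose φ hφB hφ using hφ
  have hsg : ∀ s : ℝ, ∃ γ, ∀ᶠ t in (U : Filter ℝ), σ (t + s) = γ := by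
    intro s
    obtain ⟨γ, -, h2⟩ := finite_univ.isCompact.ultrafilter_le_nhds
      (U.map fun t => σ (t + s)) (by simp)
    refine ⟨γ, ?_⟩
    have : ({γ} : Set Γ) ∈ 𝓝 γ := by simp
    exact h2 this
  choose sg hsg using hsg
  have hdomU : ∀ s, ∀ᶠ t in (U : Filter ℝ), (x (t + s), sg s) ∈ domf := fun s => by
    filter_upwards [hev s, hsg s] with t ht h2
    have := (hxK _ ht).1
    rwa [h2] at this
  have hdom : ∀ s, (φ s, sg s) ∈ domf := fun s =>
    hdomf.mem_of_tendsto ((hφ s).prodMk_nhds tendsto_const_nhds) (hdomU s)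
  refine ⟨φ, sg, ⟨?_, fun s => hBO (hφB s), hdom, ?_, ?_, ?_, ?_⟩, by simpa using hφ 0⟩
  · refine LipschitzWith.continuous (K := ⟨L, hL0⟩) (LipschitzWith.of_dist_le_mul fun v u => ?_)
    rw [dist_eq_norm, Real.dist_eq]
    refine le_of_tendsto ((hφ v).sub (hφ u)).norm ?_
    filter_upwards [hev u, hev v] with t h1 h2
    have := hlip _ _ h1 h2
    rw [add_sub_add_left_eq_sub] at this
    exact this
  · intro a b d hab hbd had
    obtain ⟨t, h1, h2, h3⟩ := ((hsg a).and ((hsg b).and (hsg d))).exists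
    rw [← h1, ← h2, ← h3]
    exact signal_D hτ hσ (by linarith) (by linarith) (by linarith)
  · intro a b hab had
    obtain ⟨t, h1, h2⟩ := ((hsg a).and (hsg b)).exists
    rw [← h1, ← h2]
    exact signal_H hτ hσ hH (by linarith) (by linarith)
  · intro γ ε hε
    have huc := hK.uniformContinuousOn_of_continuous hfK
    rw [Metric.uniformContinuousOn_iff] at huc
    obtain ⟨η, hη, huc⟩ := huc ε hε
    refine ⟨min τD (η / (L + 1)), by positivity, fun u v huv hu hv => ?_⟩
    have huv1 := lt_of_lt_of_le huv (min_le_left _ _)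
    have huv2 := lt_of_lt_of_le huv (min_le_right _ _)
    rw [lt_div_iff₀ (by linarith)] at huv2
    have hlim : Tendsto (fun t => x (t + v) - x (t + u) - (v - u) • f (x (t + u), γ)) U
        (𝓝 (φ v - φ u - (v - u) • f (φ u, γ))) := by
      refine ((hφ v).sub (hφ u)).sub (Tendsto.const_smul ?_ _)
      have hd := hdom u
      rw [hu] at hd
      refine (hf _ hd).tendsto.comp (tendsto_nhdsWithin_iff.2
        ⟨(hφ u).prodMk_nhds tendsto_const_nhds, ?_⟩)
      have := hdomU u
      rwa [hu] at this
    refine le_of_tendsto hlim.norm ?_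
    filter_upwards [hev u, hev v, hsg u, hsg v] with t ht1 ht2 ht3 ht4
    rw [hu] at ht3
    rw [hv] at ht4
    have hconst : ∀ r ∈ uIcc (t + u) (t + v), σ r = γ := by
      intro r hr
      rcases le_total u v with h | h
      · rw [uIcc_of_le (by linarith)] at hr
        rw [abs_of_nonneg (by linarith)] at huv1
        rcases signal_D hτ hσ hr.1 hr.2 (by linarith) with h' | h'
        · rw [← h', ht3]
        · rw [h', ht4]
      · rw [uIcc_of_ge (by linarith)] at hr
        rw [abs_of_nonpos (by linarith)] at huv1
        rcases signal_D hτ hσ hr.1 hr.2 (by linarith) with h' | h'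
        · rw [← h', ht4]
        · rw [h', ht3]
    obtain ⟨hi, he⟩ := htraj.intg (t + u) (hfc ht1) (t + v) (hfc ht2)
    have heq : x (t + v) - x (t + u) - (v - u) • f (x (t + u), γ) =
        ∫ s in (t + u)..(t + v), (f (x s, σ s) - f (x (t + u), γ)) := by
      rw [intervalIntegral.integral_sub hi intervalIntegrable_const,
        intervalIntegral.integral_const, he]
      rw [add_sub_cancel_left, add_sub_add_left_eq_sub]
    rw [heq, show |v - u| = |t + v - (t + u)| by ring_nf]
    refine intervalIntegral.norm_integral_le_of_norm_le_const fun s hs => ?_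
    have hs' := uIoc_subset_uIcc hs
    have hs0 : 0 ≤ s := (le_min ht1 ht2).trans hs.1.le
    rw [← dist_eq_norm, ← ht3]
    refine (huc _ (hxK s hs0) _ (hxK _ ht1) ?_).le
    rw [Prod.dist_eq]
    simp only [hconst s hs', ht3, dist_self]
    refine max_lt ?_ hη
    rw [dist_eq_norm]
    have h1 := hlip _ _ ht1 hs0
    have h2 : |s - (t + u)| ≤ |v - u| := by
      have := abs_sub_left_of_mem_uIcc hs'
      rwa [add_sub_add_left_eq_sub] at this
    have h3 : L * |s - (t + u)| ≤ L * |v - u| := mul_le_mul_of_nonneg_left h2 hL0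
    have h4 := abs_nonneg (v - u)
    linarith
  · intro s
    have h1 : Tendsto (fun t => t + s) U (atTop ⊓ 𝓟 {t | σ t = sg s}) := by
      refine tendsto_inf.2 ⟨?_, tendsto_principal.2 (hsg s)⟩
      exact (tendsto_atTop_add_const_right _ s tendsto_id).mono_left hU
    have h2 := (hc (sg s)).comp h1
    have h3 := (hV.diff (sg s) (φ s) ⟨hBO (hφB s), hdom s⟩).continuousAt.tendsto.comp (hφ s)
    exact tendsto_nhds_unique h3 h2

lemma main_aux {W : Eucl n × Γ → ℝ} {Ix : Set ℝ} (hdomf : IsClosed domf)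
    (hf : ContinuousOn f domf) (hE0 : AssumpE0 f domf) (hU : AssumpU f domf)
    (htraj : IsTrajectory f domf x σ Ix) (hfc : Ici (0 : ℝ) ⊆ Ix)
    (hσ : σ ∈ SDall Γ ∩ SH H) (hV : ClassVFun V domV domf)
    (hpre : PrecompactRel x Ix (Oset domV)) (hW : Wineq f V W domV domf)
    (hI : CondI f domf domV W) (hC : CycleAt f V domf domV W H c)
    (hc : ∀ γ, Tendsto (fun t => V (x t, γ)) (atTop ⊓ 𝓟 {t | σ t = γ}) (𝓝 (c γ))) :
    Tendsto x atTop (𝓝 0) := by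
  obtain ⟨τD, hτ, hσD⟩ := mem_iUnion₂.1 hσ.1
  rw [tendsto_iff_ultrafilter]
  intro U hUle
  obtain ⟨φ, sg, hl, hlim⟩ := exists_limTraj hdomf hf htraj hfc hτ hσD hσ.2 hV hpre hc U hUle
  rwa [hl.eq_zero hτ hdomf hf hV hW hE0 hU hI hC 0] at hlim

end Construction

noncomputable section
theorem convergence_with_cycles
    {n : ℕ} {Γ : Type*} [MetricSpace Γ] [Finite Γ]
    (f : Eucl n × Γ → Eucl n) (domf : Set (Eucl n × Γ))
    (hdomf : IsClosed domf) (hf : ContinuousOn f domf)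
    (H : Γ → Set Γ)
    (hE0 : AssumpE0 f domf) (hU : AssumpU f domf)
    (x : ℝ → Eucl n) (σ : ℝ → Γ) (Ix : Set ℝ)
    (htraj : IsTrajectory f domf x σ Ix) (hfc : Set.Ici (0 : ℝ) ⊆ Ix)
    (hσ : σ ∈ SDall Γ ∩ SH H)
    (V : Eucl n × Γ → ℝ) (domV : Set (Eucl n × Γ)) (W : Eucl n × Γ → ℝ) :
    ((AssumptionA2 domf V domV x σ Ix ∧ Wineq f V W domV domf) →
      (0 : Eucl n) ∈ Oset domV →
      CondI f domf domV W → CondCycle f domf domV W H →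
      Filter.Tendsto x Filter.atTop (nhds 0)) ∧
    ((AssumptionA1 domf V domV x σ Ix ∧ Wineq f V W domV domf) →
      (0 : Eucl n) ∈ Oset domV →
      CondI f domf domV W → CondCycle' f V domf domV W H →
      Filter.Tendsto x Filter.atTop (nhds 0)) := by
  refine ⟨?_, ?_⟩
  · rintro ⟨hA, hW⟩ - hI hC
    obtain ⟨B, hBO, hB, hxB⟩ := hA.precompact
    refine main_aux (c := fun γ => sInf ((fun t => V (x t, γ)) '' ({t | σ t = γ} ∩ Ici 0)))
      hdomf hf hE0 hU htraj hfc hσ hA.classV hA.precompact hW hI ?_ ?_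
    · intro m γs hm
      obtain ⟨j, h1, h2, h3⟩ := hC m γs hm
      exact ⟨j, h1, h2, fun ξ hb hf' _ _ => h3 ⟨hb, hf'⟩⟩
    · intro γ
      obtain ⟨m, hm⟩ := V_bddBelow hdomf hA.classV hB hBO γ
      refine tendsto_of_antitoneOn_bdd (m := m) ?_ ?_
      · intro a ha b hb hab
        have h := hA.nonincr γ ha hb hab
        have ha' : σ a = γ := ha.1
        have hb' : σ b = γ := hb.1
        simpa [ha', hb'] using h
      · intro t ht
        have ht' : σ t = γ := ht.1
        refine hm _ (hxB t (hfc ht.2)) ?_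
        have := htraj.mem t (hfc ht.2)
        rwa [ht'] at this
  · rintro ⟨hA, hW⟩ - hI hC
    obtain ⟨B, hBO, hB, hxB⟩ := hA.precompact
    refine main_aux (c := fun _ => sInf ((fun t => V (x t, σ t)) '' (univ ∩ Ici 0)))
      hdomf hf hE0 hU htraj hfc hσ hA.classV hA.precompact hW hI ?_ ?_
    · intro m γs hm
      obtain ⟨j, h1, h2, h3⟩ := hC _ m γs hm
      exact ⟨j, h1, h2, fun ξ hb hf' hv hv' => h3 ⟨⟨⟨hb, hf'⟩, hv⟩, hv'⟩⟩
    · intro γ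
      obtain ⟨m, hm⟩ := ((isCompact_K (Γ := Γ) hdomf hB).bddBelow_image
        (hA.contV.mono (inter_subset_inter_right _ (prod_mono hBO subset_rfl))))
      have h := tendsto_of_antitoneOn_bdd (v := fun t => V (x t, σ t)) (S := univ) (m := m)
        (by rw [univ_inter]; exact hA.nonincr)
        (fun t ht => hm ⟨_, ⟨htraj.mem t (hfc ht.2), hxB t (hfc ht.2), mem_univ _⟩, rfl⟩)
      refine (h.mono_left (inf_le_inf_left _ (by simp))).congr' ?_
      have h2 : ∀ᶠ t in atTop ⊓ 𝓟 {t | σ t = γ}, σ t = γ := mem_inf_of_right (mem_principal_self _)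
      filter_upwards [h2] with t ht
      rw [ht]
end
end

section
/- Suppose Assumption (E0) holds and let T be a family of forward complete trajectories of the switched system ẋ = f(x,σ) such that σ ∈ S_a for every (x,σ) ∈ T. Then T is locally asymptotically stable (LAS) if one of the following conditions holds: (1) there exists a weak Lyapunov pair (V,W) for T such that the restriction of V to dom(f) ∩ (O × Γ) is continuous and both (a) O_γ^f(f_γ,W_γ,∞) ∩ O_γ^b(f_γ,W_γ,∞) ⊆ {0} for every γ ∈ Γ and (b′) O_γ^b(f_γ,W_γ) ∩ O_{γ′}^f(f_{γ′},W_{γ′}) ∩ V_γ⁻¹(c) ∩ V_{γ′}⁻¹(c) ⊆ {0} for all γ ≠ γ′ in Γ and all c ∈ ℝ hold; (2) Assumption (U) holds and there exists a weak Lyapunov pair (V,W) for T such that W is continuous and both (a) and (b) O_γ^b(f_γ,W_γ) ∩ O_{γ′}^f(f_{γ′},W_{γ′}) ⊆ {0} for all γ ≠ γ′ in Γ hold; (3) Γ is finite and there exists an F-weak Lyapunov pair (V,W) for T such that (a) and (b) hold. If, in addition, O = ℝⁿ and V is radially unbounded, then T is globally asymptotically stable (GAS). -/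
open Filter Topology MeasureTheory Set

theorem classK_orderIso {α : ℝ → ℝ} (h : ClassK α) {R : ℝ} (hR : 0 ≤ R) :
    ∃ e : ℝ ≃o ℝ, ∀ s, 0 ≤ s → s ≤ R → e s = α s := by
  set p : ℝ → ℝ := fun s => min (max s 0) R with hp
  have hp0 : ∀ s, 0 ≤ p s := fun s => le_min (le_max_right _ _) hR
  have hpR : ∀ s, p s ≤ R := fun s => min_le_right _ _
  have hpm : Monotone p := fun a b hab => min_le_min_right _ (max_le_max_right _ hab)
  have hpc : Continuous p := by fun_prop
  have hqm : ∀ a b, a ≤ b → a - p a ≤ b - p b := by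
    intro a b hab
    simp only [hp]
    rcases le_total a 0 with h1 | h1 <;> rcases le_total b 0 with h2 | h2 <;>
      rcases le_total a R with h3 | h3 <;> rcases le_total b R with h4 | h4 <;>
      simp [h1, h2, h3, h4, hR] <;> linarith
  set g : ℝ → ℝ := fun s => α (p s) + (s - p s) with hg
  have hgm : StrictMono g := by
    intro a b hab
    simp only [hg]
    rcases (hpm hab.le).lt_or_eq with h1 | h1
    · have := h.mono (hp0 a) (hp0 b) h1
      have := hqm a b hab.le
      linarith
    · rw [h1]; linarith
  have hgc : Continuous g := by
    have : Continuous fun s => α (p s) := h.cont.comp_continuous hpc hp0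
    exact this.add (continuous_id.sub hpc)
  have hα0 : ∀ s, 0 ≤ α (p s) := fun s => by
    rw [← h.zero]; exact h.mono.monotoneOn self_mem_Ici (hp0 s) (hp0 s)
  have hαR : ∀ s, α (p s) ≤ α R := fun s =>
    h.mono.monotoneOn (hp0 s) (show (0:ℝ) ≤ R from hR) (hpR s)
  have hs : Function.Surjective g := by
    apply hgc.surjective
    · refine tendsto_atTop_mono (f := fun s => s - R) (fun s => ?_) ?_
      · have := hα0 s; have := hpR s; simp only [hg]; linarith
      · exact tendsto_atTop_add_const_right _ _ tendsto_id
    · refine tendsto_atBot_mono (f := fun s => s + α R) (fun s => ?_) ?_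
      · have := hαR s; have := hp0 s; simp only [hg]; linarith
      · exact tendsto_atBot_add_const_right _ _ tendsto_id
  refine ⟨hgm.orderIsoOfSurjective g hs, fun s h0 h1 => ?_⟩
  simp [hg, hp, h0, h1]

theorem classKInf_orderIso {α : ℝ → ℝ} (h : ClassKInf α) :
    ∃ e : ℝ ≃o ℝ, ∀ s, 0 ≤ s → e s = α s := by
  set g : ℝ → ℝ := fun s => α (max s 0) + (s - max s 0) with hg
  have hgm : StrictMono g := by
    intro a b hab
    simp only [hg]
    rcases le_or_gt b 0 with h1 | h1
    · simp [h1, hab.le.trans h1]; exact hab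
    · have h2 : max a 0 < max b 0 := by rw [max_eq_left h1.le]; exact max_lt hab h1
      have := h.mono (le_max_right a 0) (le_max_right b 0) h2
      have h3 : a - max a 0 ≤ 0 := by linarith [le_max_left a 0]
      rw [max_eq_left h1.le] at *
      linarith
  have hgc : Continuous g := by
    have : Continuous fun s : ℝ => α (max s 0) :=
      h.cont.comp_continuous (by fun_prop) (fun s => mem_Ici.2 (le_max_right _ _))
    exact this.add (by fun_prop)
  have hs : Function.Surjective g := by
    apply hgc.surjective
    · refine h.unbounded.congr' ?_
      filter_upwards [eventually_ge_atTop (0:ℝ)] with s hs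
      simp [hg, hs]
    · refine tendsto_id.congr' ?_
      filter_upwards [eventually_le_atBot (0:ℝ)] with s hs
      simp [hg, hs, h.zero]
  refine ⟨hgm.orderIsoOfSurjective g hs, fun s h0 => ?_⟩
  simp [hg, h0]

/-- the gain function. -/
noncomputable def gainFn (e : ℝ ≃o ℝ) (α₂ : ℝ → ℝ) : ℝ → ℝ := fun s => e.symm (α₂ s) + s

theorem ClassK.nonneg {α : ℝ → ℝ} (h : ClassK α) {s : ℝ} (hs : 0 ≤ s) : 0 ≤ α s := by
  rw [← h.zero]; exact h.mono.monotoneOn self_mem_Ici hs hs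

theorem gainFn_classK (e : ℝ ≃o ℝ) (he : e 0 = 0) {α₂ : ℝ → ℝ} (h : ClassK α₂) :
    ClassK (gainFn e α₂) where
  cont := (e.symm.continuous.comp_continuousOn h.cont).add continuousOn_id
  mono := by
    intro a ha b hb hab
    have := e.symm.strictMono (h.mono ha hb hab)
    simp only [gainFn]; linarith
  zero := by
    have : e.symm 0 = 0 := by rw [OrderIso.symm_apply_eq]; exact he.symm
    simp [gainFn, h.zero, this]

theorem gainFn_classKInf (e : ℝ ≃o ℝ) (he : e 0 = 0) {α₂ : ℝ → ℝ} (h : ClassK α₂) :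
    ClassKInf (gainFn e α₂) where
  toClassK := gainFn_classK e he h
  unbounded := by
    have h0 : e.symm 0 = 0 := by rw [OrderIso.symm_apply_eq]; exact he.symm
    refine tendsto_atTop_mono' _ ?_ tendsto_id
    filter_upwards [eventually_ge_atTop (0:ℝ)] with s hs
    have : e.symm 0 ≤ e.symm (α₂ s) := e.symm.monotone (h.nonneg hs)
    simp only [gainFn, id]; linarith

theorem classK_comp {α β : ℝ → ℝ} (ha : ClassK α) (hb : ClassK β) : ClassK (α ∘ β) where
  cont := ha.cont.comp hb.cont (fun s hs => hb.nonneg hs)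
  mono := fun a h b h' hab => ha.mono (hb.nonneg h) (hb.nonneg h') (hb.mono h h' hab)
  zero := by simp [hb.zero, ha.zero]

theorem classKInf_iterate {α : ℝ → ℝ} (ha : ClassKInf α) (N : ℕ) : ClassKInf (α^[N]) := by
  induction N with
  | zero =>
    exact { cont := continuousOn_id, mono := fun a _ b _ h => h, zero := rfl,
            unbounded := tendsto_id }
  | succ k ih =>
    rw [Function.iterate_succ']
    exact { toClassK := classK_comp ha.toClassK ih.toClassK
            unbounded := ha.unbounded.comp ih.unbounded }

theorem le_gain {e : ℝ ≃o ℝ} {α₁ α₂ : ℝ → ℝ} {a b v w : ℝ} (ha : 0 ≤ b) (he : e a = α₁ a)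
    (h1 : α₁ a ≤ v) (h2 : v ≤ w) (h3 : w ≤ α₂ b) : a ≤ gainFn e α₂ b := by
  have : a ≤ e.symm (α₂ b) := by
    rw [OrderIso.le_symm_apply, he]; linarith
  simp only [gainFn]; linarith

/-- Family estimate as long as the trajectory remains in `B`. -/
def EstIn {n : ℕ} {Γ : Type*} (T : Set ((ℝ → Eucl n) × (ℝ → Γ))) (B : Set (Eucl n))
    (β : ℝ → ℝ) : Prop :=
  ∀ xs ∈ T, ∀ t₀ t : ℝ, 0 ≤ t₀ → t₀ ≤ t → (∀ u ∈ Icc t₀ t, xs.1 u ∈ B) →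
    ‖xs.1 t‖ ≤ β ‖xs.1 t₀‖

section stab
variable {n : ℕ} {Γ : Type*} [TopologicalSpace Γ]
    {f : Eucl n × Γ → Eucl n} {domf : Set (Eucl n × Γ)} {V : Eucl n × Γ → ℝ}
    {domV : Set (Eucl n × Γ)} {W : Eucl n × Γ → ℝ}
    {T : Set ((ℝ → Eucl n) × (ℝ → Γ))}

theorem mem_domf (hT : ForwardCompleteFamily f domf T) {xs} (hxs : xs ∈ T) {t : ℝ}
    (ht : 0 ≤ t) : (xs.1 t, xs.2 t) ∈ domf := by
  obtain ⟨I, hI, h⟩ := hT xs hxs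
  exact h.mem t (hI ht)

theorem traj_cont (hT : ForwardCompleteFamily f domf T) {xs} (hxs : xs ∈ T) :
    ContinuousOn xs.1 (Ici 0) := by
  obtain ⟨I, hI, h⟩ := hT xs hxs
  exact h.cont.mono hI

theorem weak_est (hT : ForwardCompleteFamily f domf T)
    (h : WeakLyapunovPair f domf V domV W T) {α₁ α₂ : ℝ → ℝ} {e : ℝ ≃o ℝ} {B : Set (Eucl n)}
    (hB : B ⊆ Oset domV) (he : ∀ ξ ∈ B, e ‖ξ‖ = α₁ ‖ξ‖)
    (hb : ∀ γ : Γ, ∀ ξ ∈ Ogamma domV domf γ, α₁ ‖ξ‖ ≤ V (ξ, γ) ∧ V (ξ, γ) ≤ α₂ ‖ξ‖) :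
    EstIn T B (gainFn e α₂) := by
  intro xs hxs t₀ t h0 ht hu
  have hm := h.decreasing xs hxs t₀ t h0 ht (fun u hu' => hB (hu u hu'))
    (left_mem_Icc.2 ht) (right_mem_Icc.2 ht) ht
  have htB := hu t (right_mem_Icc.2 ht)
  have ht0B := hu t₀ (left_mem_Icc.2 ht)
  exact le_gain (norm_nonneg _) (he _ htB)
    (hb _ _ ⟨hB htB, mem_domf hT hxs (h0.trans ht)⟩).1 hm
    (hb _ _ ⟨hB ht0B, mem_domf hT hxs h0⟩).2

theorem fweak_est [Finite Γ] (hT : ForwardCompleteFamily f domf T)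
    (h : FWeakLyapunovPair f domf V domV W T) {α₁ α₂ : ℝ → ℝ} {e : ℝ ≃o ℝ} {B : Set (Eucl n)}
    (hB : B ⊆ Oset domV) (he : ∀ ξ ∈ B, e ‖ξ‖ = α₁ ‖ξ‖) (he0 : e 0 = 0) (hα₂ : ClassK α₂)
    (hb : ∀ γ : Γ, ∀ ξ ∈ Ogamma domV domf γ, α₁ ‖ξ‖ ≤ V (ξ, γ) ∧ V (ξ, γ) ≤ α₂ ‖ξ‖) :
    EstIn T B ((gainFn e α₂)^[Nat.card Γ]) := by
  have hgK := gainFn_classKInf e he0 hα₂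
  set g := gainFn e α₂ with hg
  have hsym0 : e.symm 0 = 0 := by rw [OrderIso.symm_apply_eq]; exact he0.symm
  have hge : ∀ s, 0 ≤ s → s ≤ g s := by
    intro s hs
    have : e.symm 0 ≤ e.symm (α₂ s) := e.symm.monotone (hα₂.nonneg hs)
    simp only [hg, gainFn]; linarith
  intro xs hxs t₀ t h0 ht hu
  obtain ⟨I, hI, htr⟩ := hT xs hxs
  have hcont := traj_cont hT hxs
  have key : ∀ k : ℕ, ∀ t, t₀ ≤ t → (∀ u ∈ Icc t₀ t, xs.1 u ∈ B) →
      (xs.2 '' Icc t₀ t).ncard ≤ k → ‖xs.1 t‖ ≤ g^[k] ‖xs.1 t₀‖ := by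
    intro k
    induction k with
    | zero =>
      intro t ht hu hc
      have : (xs.2 '' Icc t₀ t) = ∅ := (Set.ncard_eq_zero (Set.toFinite _)).1 (by omega)
      exact absurd this (Set.Nonempty.ne_empty ⟨_, mem_image_of_mem _ (left_mem_Icc.2 ht)⟩)
    | succ k ih =>
      intro t ht hu hc
      set A := {u | u ∈ Icc t₀ t ∧ xs.2 u = xs.2 t} with hA
      have hAne : A.Nonempty := ⟨t, right_mem_Icc.2 ht, rfl⟩
      have hAbd : BddBelow A := ⟨t₀, fun u hu => hu.1.1⟩
      set s := sInf A with hs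
      have hst0 : t₀ ≤ s := le_csInf hAne (fun u hu => hu.1.1)
      have hst : s ≤ t := csInf_le hAbd ⟨right_mem_Icc.2 ht, rfl⟩
      have hsA : xs.2 s = xs.2 t := by
        obtain ⟨ε, hε, hc⟩ := htr.signal.rightConst s
        obtain ⟨u, huA, hul⟩ := exists_lt_of_csInf_lt hAne (show sInf A < s + ε by linarith)
        rw [← hc u ⟨csInf_le hAbd huA, hul⟩]; exact huA.2
      have hstep : ‖xs.1 t‖ ≤ g ‖xs.1 s‖ := by
        have hd := h.decreasing xs hxs s t (h0.trans hst0) hst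
          (fun u hu' => hB (hu u ⟨hst0.trans hu'.1, hu'.2⟩)) (xs.2 t)
          ⟨left_mem_Icc.2 hst, hsA⟩ ⟨right_mem_Icc.2 hst, rfl⟩ hst
        have htB := hu t (right_mem_Icc.2 ht)
        have hsB := hu s ⟨hst0, hst⟩
        have hmem := mem_domf hT hxs (h0.trans hst0)
        rw [hsA] at hmem
        exact le_gain (norm_nonneg _) (he _ htB)
          (hb _ _ ⟨hB htB, mem_domf hT hxs (h0.trans ht)⟩).1 hd
          (hb _ _ ⟨hB hsB, hmem⟩).2
      have hs2 : ‖xs.1 s‖ ≤ g^[k] ‖xs.1 t₀‖ := by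
        rcases hst0.eq_or_lt with heq | hlt
        · rw [← heq]
          clear hc ih
          induction k with
          | zero => simp
          | succ k ih =>
            rw [Function.iterate_succ_apply']
            exact ih.trans (hge _ ((norm_nonneg _).trans ih))
        · have hlim : Tendsto (fun u => ‖xs.1 u‖) (𝓝[<] s) (𝓝 ‖xs.1 s‖) := by
            have : ContinuousAt xs.1 s :=
              hcont.continuousAt (Ici_mem_nhds (h0.trans_lt hlt))
            exact (this.norm.tendsto).mono_left nhdsWithin_le_nhds
          refine le_of_tendsto hlim ?_
          filter_upwards [Ioo_mem_nhdsLT hlt] with u hu'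
          refine ih u hu'.1.le (fun v hv => hu v ⟨hv.1, hv.2.trans (hu'.2.le.trans hst)⟩) ?_
          have hss : xs.2 '' Icc t₀ u ⊂ xs.2 '' Icc t₀ t := by
            refine ⟨image_mono (Icc_subset_Icc_right (hu'.2.le.trans hst)), fun hcon => ?_⟩
            obtain ⟨v, hv, hvt⟩ := hcon (mem_image_of_mem _ (right_mem_Icc.2 ht))
            have : s ≤ v := csInf_le hAbd ⟨⟨hv.1, hv.2.trans (hu'.2.le.trans hst)⟩, hvt⟩
            linarith [hv.2, hu'.2]
          have := Set.ncard_lt_ncard hss (Set.toFinite _)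
          omega
      rw [Function.iterate_succ_apply']
      have h1 : 0 ≤ ‖xs.1 s‖ := norm_nonneg _
      exact hstep.trans (hgK.mono.monotoneOn h1 (h1.trans hs2) hs2)
  refine key _ t ht hu ?_
  rw [← Set.ncard_univ]
  exact Set.ncard_le_ncard (subset_univ _) (Set.toFinite _)

theorem local_stab (hT : ForwardCompleteFamily f domf T) {R : ℝ} (hR : 0 < R) {β : ℝ → ℝ}
    (hβ : ClassK β) (h : EstIn T (Metric.closedBall 0 R) β) :
    ∃ r > 0, ∀ xs ∈ T, ∀ t₀ : ℝ, 0 ≤ t₀ → ‖xs.1 t₀‖ ≤ r → ∀ t : ℝ, t₀ ≤ t →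
      ‖xs.1 t‖ ≤ β ‖xs.1 t₀‖ ∧ ‖xs.1 t‖ ≤ R := by
  obtain ⟨r, hr0, hrR, hβr⟩ : ∃ r > 0, r < R ∧ β r < R := by
    have h1 : Tendsto β (𝓝[>] 0) (𝓝 0) := by
      have := (hβ.cont 0 self_mem_Ici).tendsto
      rw [hβ.zero] at this
      exact this.mono_left (nhdsWithin_mono _ Ioi_subset_Ici_self)
    obtain ⟨r, h2, h3⟩ := ((h1.eventually (gt_mem_nhds hR)).and (Ioo_mem_nhdsGT hR)).exists
    exact ⟨r, h3.1, h3.2, h2⟩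
  refine ⟨r, hr0, fun xs hxs t₀ h0 hx0 => ?_⟩
  have hcont := traj_cont hT hxs
  have main : ∀ t, t₀ ≤ t → ‖xs.1 t‖ < R := by
    by_contra! hcon
    obtain ⟨t', ht', hbig⟩ := hcon
    set A := {u | u ∈ Ici t₀ ∧ R ≤ ‖xs.1 u‖} with hA
    have hAne : A.Nonempty := ⟨t', ht', hbig⟩
    have hAbd : BddBelow A := ⟨t₀, fun u hu => hu.1⟩
    have hAcl : IsClosed A := by
      have : ContinuousOn (fun u => ‖xs.1 u‖) (Ici t₀) :=
        (hcont.mono (Ici_subset_Ici.2 h0)).norm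
      exact this.preimage_isClosed_of_isClosed isClosed_Ici isClosed_Ici
    have hsA := hAcl.csInf_mem hAne hAbd
    set s := sInf A
    have hle : ∀ u ∈ Ico t₀ s, ‖xs.1 u‖ < R := by
      intro u hu
      by_contra! hc
      exact absurd (csInf_le hAbd ⟨hu.1, hc⟩) (not_le.2 hu.2)
    have hlt : t₀ < s := by
      rcases (show t₀ ≤ s from hsA.1).eq_or_lt with h1 | h1
      · have := hsA.2; rw [← h1] at this; linarith
      · exact h1
    have hsR : ‖xs.1 s‖ ≤ R := by
      have hlim : Tendsto (fun u => ‖xs.1 u‖) (𝓝[<] s) (𝓝 ‖xs.1 s‖) := by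
        have : ContinuousAt xs.1 s := hcont.continuousAt (Ici_mem_nhds (h0.trans_lt hlt))
        exact (this.norm.tendsto).mono_left nhdsWithin_le_nhds
      refine le_of_tendsto hlim ?_
      filter_upwards [Ioo_mem_nhdsLT hlt] with u hu'
      exact (hle u ⟨hu'.1.le, hu'.2⟩).le
    have := h xs hxs t₀ s h0 hlt.le (fun u hu => by
      rw [mem_closedBall_zero_iff]
      rcases hu.2.eq_or_lt with h1 | h1
      · rw [h1]; exact hsR
      · exact (hle u ⟨hu.1, h1⟩).le)
    have h2 := hβ.mono.monotoneOn (norm_nonneg (xs.1 t₀)) hr0.le hx0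
    linarith [hsA.2]
  intro t ht
  refine ⟨h xs hxs t₀ t h0 ht (fun u hu => ?_), (main t ht).le⟩
  rw [mem_closedBall_zero_iff]; exact (main u hu.1).le

end stab

section sig
variable {Γ : Type*}

theorem const_of_locConst {σ : ℝ → Γ} {a b : ℝ}
    (h : ∀ t ∈ Ioo a b, ∃ ε > 0, ∀ u ∈ Ioo (t - ε) (t + ε), σ u = σ t) :
    ∀ u ∈ Ioo a b, ∀ v ∈ Ioo a b, σ u = σ v := by
  intro u hu v hv
  refine isPreconnected_Ioo.induction₂ (fun x y => σ x = σ y) (fun t ht => ?_)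
    (fun x y z _ _ _ h1 h2 => h1.trans h2) (fun x y _ _ h => h.symm) hu hv
  obtain ⟨ε, hε, hc⟩ := h t ht
  have : Ioo (t - ε) (t + ε) ∈ 𝓝[Ioo a b] t :=
    mem_nhdsWithin_of_mem_nhds (Ioo_mem_nhds (by linarith) (by linarith))
  filter_upwards [this] with y hy
  exact (hc y hy).symm

theorem signal_const [TopologicalSpace Γ] [T2Space Γ] {σ : ℝ → Γ} (h : IsSwitchingSignal σ)
    {a b : ℝ} (hj : ∀ u ∈ Ioo a b, u ∉ JumpTimes σ) :
    ∀ u ∈ Ioo a b, ∀ v ∈ Ioo a b, σ u = σ v := by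
  apply const_of_locConst
  intro t ht
  have hc : ContinuousAt σ t := by
    have := hj t ht
    simpa [JumpTimes] using this
  obtain ⟨ε₁, hε₁, h1⟩ := h.rightConst t
  obtain ⟨ε₂, hε₂, h2⟩ := h.leftConst t
  have hleft : ∀ u ∈ Ioo (t - ε₂) t, σ u = σ t := by
    intro u hu
    have l1 : Tendsto σ (𝓝[<] t) (𝓝 (σ t)) := hc.tendsto.mono_left nhdsWithin_le_nhds
    have l2 : Tendsto σ (𝓝[<] t) (𝓝 (σ u)) := by
      refine tendsto_const_nhds.congr' ?_
      filter_upwards [Ioo_mem_nhdsLT (show t - ε₂ < t by linarith)] with v hv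
      exact h2 u hu v hv
    exact tendsto_nhds_unique l2 l1
  refine ⟨min ε₁ ε₂, lt_min hε₁ hε₂, fun u hu => ?_⟩
  rcases lt_or_ge u t with h3 | h3
  · exact hleft u ⟨by linarith [hu.1, min_le_right ε₁ ε₂], h3⟩
  · exact h1 u ⟨h3, by linarith [hu.2, min_le_left ε₁ ε₂]⟩

structure GoodStr (G : Set ℝ) (σ : ℝ → Γ) : Prop where
  loc : ∀ t ∈ G, ∃ ε > 0, ∀ u ∈ Ioo (t - ε) (t + ε), u ∈ G ∧ σ u = σ t
  right : ∀ t, ∃ ε > 0, Ioo t (t + ε) ⊆ G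
  left : ∀ t, ∃ ε > 0, Ioo (t - ε) t ⊆ G
  cnt : (Gᶜ).Countable

theorem GoodStr.const {G : Set ℝ} {σ : ℝ → Γ} (h : GoodStr G σ) {a b : ℝ}
    (hab : Ioo a b ⊆ G) : ∀ u ∈ Ioo a b, ∀ v ∈ Ioo a b, σ u = σ v :=
  const_of_locConst (fun t ht => by
    obtain ⟨ε, hε, hc⟩ := h.loc t (hab ht)
    exact ⟨ε, hε, fun u hu => (hc u hu).2⟩)

theorem GoodStr.right_alt {G : Set ℝ} {σ : ℝ → Γ} (h : GoodStr G σ) {t₀ : ℝ} (ht₀ : t₀ ∈ G) :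
    (∀ t ∈ G, t₀ < t → σ t = σ t₀) ∨
    ∃ b > t₀, (∀ t ∈ G, t ∈ Ioo t₀ b → σ t = σ t₀) ∧
      ∃ ε > 0, ∃ γ' ≠ σ t₀, ∀ t ∈ Ioo b (b + ε), σ t = γ' := by
  by_cases hall : ∀ t ∈ G, t₀ < t → σ t = σ t₀
  · exact Or.inl hall
  right
  push Not at hall
  obtain ⟨t₁, ht₁, hlt, hne⟩ := hall
  set S := {t | t ∈ G ∧ t₀ < t ∧ σ t ≠ σ t₀} with hS
  have hSne : S.Nonempty := ⟨t₁, ht₁, hlt, hne⟩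
  have hSbd : BddBelow S := ⟨t₀, fun t ht => ht.2.1.le⟩
  set b := sInf S with hb
  obtain ⟨ε₀, hε₀, hl⟩ := h.loc t₀ ht₀
  have hb0 : t₀ + ε₀ ≤ b := by
    refine le_csInf hSne (fun t ht => ?_)
    by_contra! hc
    exact ht.2.2 (hl t ⟨by linarith [ht.2.1], hc⟩).2
  have hbefore : ∀ t ∈ G, t ∈ Ioo t₀ b → σ t = σ t₀ := by
    intro t htG ht
    by_contra hc
    exact absurd (csInf_le hSbd ⟨htG, ht.1, hc⟩) (not_le.2 ht.2)
  have hbS : b ∉ S := by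
    intro hbS
    obtain ⟨ε₁, hε₁, hl1⟩ := h.loc b hbS.1
    set m := max (t₀ + ε₀ / 2) (b - ε₁ / 2) with hm
    have hmb : m < b := max_lt (by linarith) (by linarith)
    have hm1 : t₀ < m := lt_of_lt_of_le (by linarith) (le_max_left _ _)
    have hm2 : b - ε₁ < m := lt_of_lt_of_le (by linarith) (le_max_right _ _)
    have h1 := hl1 m ⟨hm2, by linarith⟩
    exact hbS.2.2 (h1.2.symm.trans (hbefore m h1.1 ⟨hm1, hmb⟩))
  refine ⟨b, by linarith, hbefore, ?_⟩
  obtain ⟨ε, hε, hr⟩ := h.right b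
  obtain ⟨t₂, ht₂, hlt₂⟩ := exists_lt_of_csInf_lt hSne (show sInf S < b + ε by linarith)
  have hbt : b < t₂ := by
    refine lt_of_le_of_ne (csInf_le hSbd ht₂) (fun heq => hbS (heq ▸ ht₂))
  exact ⟨ε, hε, σ t₂, ht₂.2.2, fun t ht => h.const hr t ht t₂ ⟨hbt, hlt₂⟩⟩

theorem GoodStr.neg {G : Set ℝ} {σ : ℝ → Γ} (h : GoodStr G σ) :
    GoodStr {t | -t ∈ G} (fun t => σ (-t)) where
  loc := by
    intro t ht
    obtain ⟨ε, hε, hl⟩ := h.loc (-t) ht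
    exact ⟨ε, hε, fun u hu => hl (-u) ⟨by linarith [hu.2], by linarith [hu.1]⟩⟩
  right := by
    intro t
    obtain ⟨ε, hε, hl⟩ := h.left (-t)
    exact ⟨ε, hε, fun u hu => hl ⟨by linarith [hu.2], by linarith [hu.1]⟩⟩
  left := by
    intro t
    obtain ⟨ε, hε, hl⟩ := h.right (-t)
    exact ⟨ε, hε, fun u hu => hl ⟨by linarith [hu.2], by linarith [hu.1]⟩⟩
  cnt := h.cnt.preimage neg_injective

theorem GoodStr.left_alt {G : Set ℝ} {σ : ℝ → Γ} (h : GoodStr G σ) {t₀ : ℝ} (ht₀ : t₀ ∈ G) :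
    (∀ t ∈ G, t < t₀ → σ t = σ t₀) ∨
    ∃ b < t₀, (∀ t ∈ G, t ∈ Ioo b t₀ → σ t = σ t₀) ∧
      ∃ ε > 0, ∃ γ' ≠ σ t₀, ∀ t ∈ Ioo (b - ε) b, σ t = γ' := by
  have h0 : -t₀ ∈ {t : ℝ | -t ∈ G} := by simpa using ht₀
  rcases h.neg.right_alt h0 with h1 | ⟨b, hb, h1, ε, hε, γ', hγ, h2⟩
  · left
    intro t ht hlt
    have := h1 (-t) (by simpa using ht) (by linarith)
    simpa using this
  · right
    refine ⟨-b, by linarith, fun t ht hlt => ?_, ε, hε, γ', by simpa using hγ, fun t ht => ?_⟩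
    · have := h1 (-t) (by simpa using ht) ⟨by linarith [hlt.2], by linarith [hlt.1]⟩
      simpa using this
    · have := h2 (-t) ⟨by linarith [ht.2], by linarith [ht.1]⟩
      simpa using this

theorem GoodStr.dense {G : Set ℝ} {σ : ℝ → Γ} (h : GoodStr G σ) {a b : ℝ} (hab : a < b)
    {t : ℝ} (ht : t ∈ Icc a b) : t ∈ closure (G ∩ Ioo a b) := by
  rcases ht.2.lt_or_eq with h1 | h1
  · obtain ⟨ε, hε, hr⟩ := h.right t
    have hlt : t < min (t + ε) b := lt_min (by linarith) h1
    have : Ioo t (min (t + ε) b) ⊆ G ∩ Ioo a b := fun u hu =>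
      ⟨hr ⟨hu.1, hu.2.trans_le (min_le_left _ _)⟩, ht.1.trans_lt hu.1,
        hu.2.trans_le (min_le_right _ _)⟩
    refine closure_mono this ?_
    rw [closure_Ioo hlt.ne]; exact left_mem_Icc.2 hlt.le
  · obtain ⟨ε, hε, hr⟩ := h.left t
    have hlt : max (t - ε) a < t := max_lt (by linarith) (h1 ▸ hab)
    have : Ioo (max (t - ε) a) t ⊆ G ∩ Ioo a b := fun u hu =>
      ⟨hr ⟨(le_max_left _ _).trans_lt hu.1, hu.2⟩, (le_max_right _ _).trans_lt hu.1,
        hu.2.trans_le ht.2⟩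
    refine closure_mono this ?_
    rw [closure_Ioo hlt.ne]; exact right_mem_Icc.2 hlt.le
end sig

section lim
variable {n : ℕ} {Γ : Type*} [TopologicalSpace Γ]

structure LimSys (f : Eucl n × Γ → Eucl n) (domf : Set (Eucl n × Γ)) (O : Set (Eucl n))
    (G : Set ℝ) (x : ℝ → Eucl n) (σ : ℝ → Γ) : Prop where
  good : GoodStr G σ
  cont : Continuous x
  deriv : ∀ t ∈ G, HasDerivAt x (f (x t, σ t)) t
  mem : ∀ t, (x t, σ t) ∈ domf
  memO : ∀ t, x t ∈ O

def Md (G : Set ℝ) (σ : ℝ → Γ) (a b : ℝ) (γ : Γ) : Prop := ∀ t ∈ G, t ∈ Ioo a b → σ t = γ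

variable {f : Eucl n × Γ → Eucl n} {domf : Set (Eucl n × Γ)} {O : Set (Eucl n)}
  {G : Set ℝ} {x : ℝ → Eucl n} {σ : ℝ → Γ} {a b : ℝ} {γ : Γ}

theorem LimSys.piece_mem (L : LimSys f domf O G x σ) (hd : IsClosed domf) (hab : a < b)
    (hm : Md G σ a b γ) : ∀ t ∈ Icc a b, (x t, γ) ∈ domf := by
  intro t ht
  have hcl : IsClosed {t | (x t, γ) ∈ domf} :=
    hd.preimage (L.cont.prodMk continuous_const)
  refine hcl.closure_subset_iff.2 ?_ (L.good.dense hab ht)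
  intro u hu
  have := L.mem u
  rwa [hm u hu.1 hu.2] at this

theorem LimSys.piece_cont (L : LimSys f domf O G x σ) (hd : IsClosed domf)
    (hf : ContinuousOn f domf) (hab : a < b)
    (hm : Md G σ a b γ) : ContinuousOn (fun t => f (x t, γ)) (Icc a b) :=
  hf.comp (L.cont.prodMk continuous_const).continuousOn (L.piece_mem hd hab hm)

theorem LimSys.piece_int (L : LimSys f domf O G x σ) (hd : IsClosed domf)
    (hf : ContinuousOn f domf) (hab : a < b)
    (hm : Md G σ a b γ) {t₀ t : ℝ} (h0 : t₀ ∈ Icc a b) (ht : t ∈ Icc a b) :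
    IntervalIntegrable (fun s => f (x s, γ)) volume t₀ t ∧
    x t = x t₀ + ∫ s in t₀..t, f (x s, γ) := by
  have hsub : uIcc t₀ t ⊆ Icc a b := ordConnected_Icc.uIcc_subset h0 ht
  have hi : IntervalIntegrable (fun s => f (x s, γ)) volume t₀ t :=
    ((L.piece_cont hd hf hab hm).mono hsub).intervalIntegrable
  refine ⟨hi, ?_⟩
  have := integral_eq_of_hasDerivAt_off_countable x (fun s => f (x s, γ)) L.good.cnt
    (a := t₀) (b := t) L.cont.continuousOn (fun u hu => by
      have huG : u ∈ G := by simpa using hu.2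
      have h1 := L.deriv u huG
      rwa [hm u huG ⟨(le_min h0.1 ht.1).trans_lt hu.1.1,
        hu.1.2.trans_le (max_le h0.2 ht.2)⟩] at h1) hi
  rw [this]; abel

theorem LimSys.piece_deriv (L : LimSys f domf O G x σ) (hd : IsClosed domf)
    (hf : ContinuousOn f domf) (hab : a < b)
    (hm : Md G σ a b γ) {t : ℝ} (ht : t ∈ Icc a b) :
    HasDerivWithinAt x (f (x t, γ)) (Icc a b) t := by
  have hc := L.piece_cont hd hf hab hm
  have ha : a ∈ Icc a b := left_mem_Icc.2 hab.le
  have h1 : HasDerivWithinAt (fun u => ∫ s in a..u, f (x s, γ)) (f (x t, γ)) (Icc a b) t := by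
    have : Fact (t ∈ Icc a b) := ⟨ht⟩
    refine intervalIntegral.integral_hasDerivWithinAt_right
      (L.piece_int hd hf hab hm ha ht).1 ?_ (hc t ht)
    exact hc.stronglyMeasurableAtFilter_nhdsWithin measurableSet_Icc t
  have h2 := h1.const_add (x a)
  refine h2.congr (fun u hu => (L.piece_int hd hf hab hm ha hu).2)
    (L.piece_int hd hf hab hm ha ht).2

theorem LimSys.isSol {domV : Set (Eucl n × Γ)} (L : LimSys f domf (Oset domV) G x σ)
    (hd : IsClosed domf)
    (hf : ContinuousOn f domf) (c : ℝ) (J : Set ℝ)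
    (H : ∀ t₀ ∈ J, ∀ t ∈ J, ∃ a b, a < b ∧ Md G σ a b γ ∧ t₀ + c ∈ Icc a b ∧ t + c ∈ Icc a b) :
    IsSolOn (fun ξ => f (ξ, γ)) (Ogamma domV domf γ) (fun t => x (t + c)) J := by
  refine ⟨(L.cont.comp (by fun_prop)).continuousOn, fun t ht => ?_, fun t₀ h0 t ht => ?_⟩
  · obtain ⟨a, b, hab, hm, h1, -⟩ := H t ht t ht
    exact ⟨L.memO _, L.piece_mem hd hab hm _ h1⟩
  · obtain ⟨a, b, hab, hm, h1, h2⟩ := H t₀ h0 t ht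
    obtain ⟨h3, h4⟩ := L.piece_int hd hf hab hm h1 h2
    refine ⟨?_, ?_⟩
    · have := h3.comp_add_right c
      simpa using this
    · refine h4.trans ?_
      congr 1
      exact (intervalIntegral.integral_comp_add_right (fun s => f (x s, γ)) c).symm

theorem LimSys.zero {domV : Set (Eucl n × Γ)} {W : Eucl n × Γ → ℝ}
    (L : LimSys f domf (Oset domV) G x σ) (hd : IsClosed domf)
    (hf : ContinuousOn f domf) (hA : CondA f domf domV W)
    (hW : ∀ a b γ, a < b → Md G σ a b γ → ∀ t ∈ Icc a b, W (x t, γ) = 0)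
    (hJ : ∀ γ γ' a b d, a < b → b < d → Md G σ a b γ → Md G σ b d γ' → γ ≠ γ' →
      x b ∈ XBwdFin (Ogamma domV domf γ) (fun ξ => f (ξ, γ)) (fun ξ => W (ξ, γ)) →
      x b ∈ XFwdFin (Ogamma domV domf γ') (fun ξ => f (ξ, γ')) (fun ξ => W (ξ, γ')) → x b = 0)
    (hZ : ∀ a b γ, a < b → Md G σ a b γ → ∀ t₁ ∈ Icc a b, x t₁ = 0 → ∀ t ∈ Icc a b, x t = 0) :
    ∀ t, x t = 0 := by
  have hJ' : ∀ γ γ' a b d, a < b → b < d → Md G σ a b γ → Md G σ b d γ' → γ ≠ γ' → x b = 0 := by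
    intro γ γ' a b d hab hbd hm hm' hne
    refine hJ γ γ' a b d hab hbd hm hm' hne ?_ ?_
    · simp only [XBwdFin, mem_iUnion]
      refine ⟨b - a, by simpa using hab, fun t => x (t + b),
        L.isSol hd hf b _ (fun t₀ h0 t ht => ⟨a, b, hab, hm, ?_, ?_⟩), by simp, fun t ht => ?_⟩
      · constructor <;> linarith [h0.1, h0.2]
      · constructor <;> linarith [ht.1, ht.2]
      · exact hW a b γ hab hm _ (by constructor <;> linarith [ht.1, ht.2])
    · simp only [XFwdFin, mem_iUnion]
      refine ⟨d - b, by simpa using hbd, fun t => x (t + b),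
        L.isSol hd hf b _ (fun t₀ h0 t ht => ⟨b, d, hbd, hm', ?_, ?_⟩), by simp, fun t ht => ?_⟩
      · constructor <;> linarith [h0.1, h0.2]
      · constructor <;> linarith [ht.1, ht.2]
      · exact hW b d γ' hbd hm' _ (by constructor <;> linarith [ht.1, ht.2])
  have hgood : ∀ t₀ ∈ G, x t₀ = 0 := by
    intro t₀ ht₀
    rcases L.good.right_alt ht₀ with hR | ⟨b, hb, h1, ε, hε, γ', hne, h2⟩
    · rcases L.good.left_alt ht₀ with hL | ⟨b, hb, h1, ε, hε, γ', hne, h2⟩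
      · have hall : ∀ a b, Md G σ a b (σ t₀) := by
          intro a b t ht _
          rcases lt_trichotomy t t₀ with h | h | h
          · exact hL t ht h
          · rw [h]
          · exact hR t ht h
        have hsol : ∀ J, IsSolOn (fun ξ => f (ξ, σ t₀)) (Ogamma domV domf (σ t₀))
            (fun t => x (t + t₀)) J := fun J => L.isSol hd hf t₀ J (fun t₁ _ t₂ _ =>
              ⟨min t₁ t₂ + t₀ - 1, max t₁ t₂ + t₀ + 1,
                by linarith [min_le_max (a := t₁) (b := t₂)], hall _ _,
                ⟨by linarith [min_le_left t₁ t₂], by linarith [le_max_left t₁ t₂]⟩,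
                ⟨by linarith [min_le_right t₁ t₂], by linarith [le_max_right t₁ t₂]⟩⟩)
        have hW' : ∀ t, W (x t, σ t₀) = 0 := fun t =>
          hW (t - 1) (t + 1) _ (by linarith) (hall _ _) t ⟨by linarith, by linarith⟩
        exact hA (σ t₀) ⟨⟨_, hsol _, by simp, fun t _ => hW' _⟩,
          ⟨_, hsol _, by simp, fun t _ => hW' _⟩⟩
      · have hm : Md G σ b t₀ (σ t₀) := h1
        have hm' : Md G σ (b - ε) b γ' := fun t _ ht => h2 t ht
        have hz := hJ' _ _ _ _ _ (by linarith) hb hm' hm hne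
        exact hZ b t₀ _ hb hm b (left_mem_Icc.2 hb.le) hz t₀ (right_mem_Icc.2 hb.le)
    · have hm : Md G σ t₀ b (σ t₀) := h1
      have hm' : Md G σ b (b + ε) γ' := fun t _ ht => h2 t ht
      have hz := hJ' _ _ _ _ _ hb (by linarith) hm hm' hne.symm
      exact hZ t₀ b _ hb hm b (right_mem_Icc.2 hb.le) hz t₀ (left_mem_Icc.2 hb.le)
  intro t
  have hcl : IsClosed {t | x t = 0} := isClosed_eq L.cont continuous_const
  refine hcl.closure_subset_iff.2 (fun u hu => hgood u hu.1)
    (L.good.dense (show t - 1 < t + 1 by linarith) ⟨by linarith, by linarith⟩)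

end lim

section exlim
variable {n : ℕ} {Γ : Type*}

def goodSet [TopologicalSpace Γ] (σ : ℝ → Γ) (U : Ultrafilter ℝ) : Set ℝ :=
  {t | ∃ ε > 0, ∀ᶠ s in (U : Filter ℝ), ∀ u ∈ Ioo (t - ε) (t + ε), s + u ∉ JumpTimes σ}

theorem bad_finite [TopologicalSpace Γ] {σ : ℝ → Γ} {τD : ℝ} {N₀ : ℕ} (hσ : σ ∈ SA Γ τD N₀)
    (U : Ultrafilter ℝ) (M : ℝ) (hM : 0 < M) : ((goodSet σ U)ᶜ ∩ Ioo (-M) M).Finite := by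
  by_contra hinf
  obtain ⟨F, hF, hcard⟩ := Set.Infinite.exists_subset_card_eq hinf
    (⌈(N₀ : ℝ) + (2 * M) / τD⌉₊ + 1)
  obtain ⟨Q, hQ, hdis⟩ := F.finite_toSet.t2_separation
  have hev : ∀ᶠ s in (U : Filter ℝ), ∀ t ∈ F, ∃ u ∈ Q t ∩ Ioo (-M) M, s + u ∈ JumpTimes σ := by
    rw [Finset.eventually_all]
    intro t ht
    have htb := hF ht
    have hop : Q t ∩ Ioo (-M) M ∈ 𝓝 t :=
      ((hQ t).2.inter isOpen_Ioo).mem_nhds ⟨(hQ t).1, htb.2⟩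
    obtain ⟨ε, hε, hsub⟩ := Metric.mem_nhds_iff.1 hop
    rw [Real.ball_eq_Ioo] at hsub
    have h1 : ¬ ∀ᶠ s in (U : Filter ℝ), ∀ u ∈ Ioo (t - ε) (t + ε), s + u ∉ JumpTimes σ :=
      fun h => htb.1 ⟨ε, hε, h⟩
    rw [← Ultrafilter.eventually_not] at h1
    filter_upwards [h1] with s hs
    push Not at hs
    obtain ⟨u, hu, hj⟩ := hs
    exact ⟨u, hsub hu, hj⟩
  obtain ⟨s, hs⟩ := hev.exists
  choose! u hu hj using hs
  have hfin : (JumpTimes σ ∩ Ioo (s - M) (s + M)).Finite :=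
    (hσ.1.locFinite (s - M) (s + M)).subset (inter_subset_inter_right _ Ioo_subset_Icc_self)
  have hle : (F : Set ℝ).ncard ≤ (JumpTimes σ ∩ Ioo (s - M) (s + M)).ncard := by
    refine Set.ncard_le_ncard_of_injOn (fun t => s + u t) (fun t ht => ⟨hj t ht, ?_⟩) ?_ hfin
    · have := (hu t ht).2
      exact ⟨by linarith [this.1], by linarith [this.2]⟩
    · intro t ht t' ht' heq
      by_contra hne
      have h1 : u t = u t' := by simpa using heq
      have h2 := hdis ht ht' hne
      exact (Set.disjoint_left.1 h2) (hu t ht).1 (h1 ▸ (hu t' ht').1)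
  rw [Set.ncard_coe_finset, hcard] at hle
  have h2 := hσ.2 (s - M) (s + M) (by linarith)
  have h3 : (s + M - (s - M)) / τD = 2 * M / τD := by ring_nf
  rw [h3] at h2
  have h4 : (((⌈(N₀ : ℝ) + (2 * M) / τD⌉₊ + 1 : ℕ) : ℝ)) ≤
      ((JumpTimes σ ∩ Ioo (s - M) (s + M)).ncard : ℝ) := by exact_mod_cast hle
  have h5 := Nat.le_ceil ((N₀ : ℝ) + (2 * M) / τD)
  push_cast at h4
  linarith

theorem bad_nbhd [TopologicalSpace Γ] {σ : ℝ → Γ} {τD : ℝ} {N₀ : ℕ} (hσ : σ ∈ SA Γ τD N₀)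
    (U : Ultrafilter ℝ) (t : ℝ) :
    ∃ ε > 0, ∀ u ∈ Ioo (t - ε) (t + ε), u ≠ t → u ∈ goodSet σ U := by
  have hM : 0 < |t| + 1 := by positivity
  have hfin := bad_finite hσ U (|t| + 1) hM
  have hcl := (hfin.subset (Set.sdiff_subset (t := {t}))).isClosed
  have h1 : (((goodSet σ U)ᶜ ∩ Ioo (-(|t| + 1)) (|t| + 1)) \ {t})ᶜ ∩
      Ioo (-(|t| + 1)) (|t| + 1) ∈ 𝓝 t := by
    refine inter_mem (hcl.isOpen_compl.mem_nhds (by simp)) (Ioo_mem_nhds ?_ ?_)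
    · linarith [neg_abs_le t]
    · linarith [le_abs_self t]
  obtain ⟨ε, hε, hsub⟩ := Metric.mem_nhds_iff.1 h1
  rw [Real.ball_eq_Ioo] at hsub
  refine ⟨ε, hε, fun u hu hne => ?_⟩
  have h2 := hsub hu
  by_contra hc
  exact h2.1 ⟨⟨hc, h2.2⟩, hne⟩

theorem bad_countable [TopologicalSpace Γ] {σ : ℝ → Γ} {τD : ℝ} {N₀ : ℕ} (hσ : σ ∈ SA Γ τD N₀)
    (U : Ultrafilter ℝ) : ((goodSet σ U)ᶜ).Countable := by
  have : (goodSet σ U)ᶜ ⊆ ⋃ k : ℕ, ((goodSet σ U)ᶜ ∩ Ioo (-((k : ℝ) + 1)) ((k : ℝ) + 1)) := by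
    intro t ht
    obtain ⟨k, hk⟩ := exists_nat_gt |t|
    rw [abs_lt] at hk
    exact mem_iUnion.2 ⟨k, ht, by linarith [hk.1], by linarith [hk.2]⟩
  refine Set.Countable.mono this (Set.countable_iUnion fun k => ?_)
  exact (bad_finite hσ U _ (by positivity)).countable

/-- Bounded trajectory data on `[0,∞)`. -/
structure BTraj [TopologicalSpace Γ] (f : Eucl n × Γ → Eucl n) (domf : Set (Eucl n × Γ))
    (B : Set (Eucl n)) (L : ℝ) (x : ℝ → Eucl n) (σ : ℝ → Γ) : Prop where
  mem : ∀ t, 0 ≤ t → (x t, σ t) ∈ domf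
  memB : ∀ t, 0 ≤ t → x t ∈ B
  intg : ∀ t₀, 0 ≤ t₀ → ∀ t, 0 ≤ t →
    IntervalIntegrable (fun s => f (x s, σ s)) volume t₀ t ∧
    x t = x t₀ + ∫ s in t₀..t, f (x s, σ s)
  lip : ∀ t₀, 0 ≤ t₀ → ∀ t, 0 ≤ t → ‖x t - x t₀‖ ≤ L * |t - t₀|

theorem exists_btraj [TopologicalSpace Γ] [CompactSpace Γ] {f : Eucl n × Γ → Eucl n}
    {domf : Set (Eucl n × Γ)} (hd : IsClosed domf) (hf : ContinuousOn f domf)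
    {B : Set (Eucl n)} (hB : IsCompact B) {x : ℝ → Eucl n} {σ : ℝ → Γ} {I : Set ℝ}
    (hI : Ici (0 : ℝ) ⊆ I) (h : IsTrajectory f domf x σ I) (hx : ∀ t, 0 ≤ t → x t ∈ B) :
    ∃ L ≥ 0, BTraj f domf B L x σ := by
  have hK : IsCompact (domf ∩ (B ×ˢ (univ : Set Γ))) := (hB.prod isCompact_univ).inter_left hd
  obtain ⟨L, hL⟩ := hK.exists_bound_of_continuousOn (hf.mono inter_subset_left)
  refine ⟨max L 0, le_max_right _ _, fun t ht => h.mem t (hI ht), hx,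
    fun t₀ h0 t ht => h.intg t₀ (hI h0) t (hI ht), fun t₀ h0 t ht => ?_⟩
  have h1 := (h.intg t₀ (hI h0) t (hI ht)).2
  rw [h1, add_sub_cancel_left]
  refine intervalIntegral.norm_integral_le_of_norm_le_const (fun u hu => ?_)
  have hu0 : 0 ≤ u := (le_min h0 ht).trans hu.1.le
  exact (hL _ ⟨h.mem u (hI hu0), hx u hu0, mem_univ _⟩).trans (le_max_left _ _)

theorem ev_nonneg {U : Ultrafilter ℝ} (hU : (U : Filter ℝ) ≤ atTop) (t : ℝ) :
    ∀ᶠ s in (U : Filter ℝ), 0 ≤ s + t := by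
  filter_upwards [hU (eventually_ge_atTop (-t))] with s hs
  linarith

/-- `σ(s+·)` is eventually constant near good times. -/
theorem good_const [TopologicalSpace Γ] [T2Space Γ] {σ : ℝ → Γ} (hσ : IsSwitchingSignal σ)
    {U : Ultrafilter ℝ} {t : ℝ} (ht : t ∈ goodSet σ U) :
    ∃ ε > 0, ∀ᶠ s in (U : Filter ℝ), ∀ u ∈ Ioo (t - ε) (t + ε), σ (s + u) = σ (s + t) := by
  obtain ⟨ε, hε, hev⟩ := ht
  refine ⟨ε, hε, ?_⟩
  filter_upwards [hev] with s hs u hu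
  refine signal_const hσ (a := s + (t - ε)) (b := s + (t + ε)) (fun v hv => ?_) _
    ⟨by linarith [hu.1], by linarith [hu.2]⟩ _ ⟨by linarith, by linarith⟩
  have := hs (v - s) ⟨by linarith [hv.1], by linarith [hv.2]⟩
  simpa using this

/-- Any neighborhood of the limit point is eventually visited near a good time. -/
theorem ev_near [TopologicalSpace Γ] [T2Space Γ] {f : Eucl n × Γ → Eucl n}
    {domf : Set (Eucl n × Γ)} {B : Set (Eucl n)} {L : ℝ} (hL : 0 ≤ L) {x : ℝ → Eucl n}
    {σ : ℝ → Γ} (h : BTraj f domf B L x σ) (hσ : IsSwitchingSignal σ)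
    {U : Ultrafilter ℝ} (hU : (U : Filter ℝ) ≤ atTop) {t : ℝ} (ht : t ∈ goodSet σ U)
    {p : Eucl n × Γ}
    (hlim : Tendsto (fun s => (x (s + t), σ (s + t))) (U : Filter ℝ) (𝓝 p))
    {N : Set (Eucl n × Γ)} (hN : N ∈ 𝓝 p) :
    ∃ δ > 0, ∀ᶠ s in (U : Filter ℝ), ∀ u ∈ Ioo (t - δ) (t + δ), 0 ≤ s + u ∧
      σ (s + u) = σ (s + t) ∧ (x (s + u), σ (s + u)) ∈ N := by
  obtain ⟨ε, hε, hc⟩ := good_const hσ ht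
  obtain ⟨N₁, hN₁, N₂, hN₂, hsub⟩ := mem_nhds_prod_iff.1 hN
  obtain ⟨r, hr, hball⟩ := Metric.mem_nhds_iff.1 hN₁
  have hδ : 0 < min ε (r / (2 * (L + 1))) := lt_min hε (by positivity)
  refine ⟨min ε (r / (2 * (L + 1))), hδ, ?_⟩
  have l1 : ∀ᶠ s in (U : Filter ℝ), x (s + t) ∈ Metric.ball p.1 (r / 2) :=
    ((continuous_fst.tendsto p).comp hlim).eventually (Metric.ball_mem_nhds _ (by positivity))
  have l2 : ∀ᶠ s in (U : Filter ℝ), σ (s + t) ∈ N₂ :=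
    ((continuous_snd.tendsto p).comp hlim).eventually hN₂
  filter_upwards [l1, l2, hc, ev_nonneg hU (t - min ε (r / (2 * (L + 1))))]
    with s h1 h2 h3 h4 u hu
  have hu0 : 0 ≤ s + u := by linarith [hu.1]
  have hσu := h3 u ⟨by linarith [hu.1, min_le_left ε (r / (2 * (L + 1)))],
    by linarith [hu.2, min_le_left ε (r / (2 * (L + 1)))]⟩
  refine ⟨hu0, hσu, hsub ⟨hball ?_, by rw [hσu]; exact h2⟩⟩
  have h5 := h.lip (s + t) (by linarith) (s + u) hu0
  have h6 : |s + u - (s + t)| ≤ r / (2 * (L + 1)) := by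
    rw [abs_le]
    have := min_le_right ε (r / (2 * (L + 1)))
    constructor <;> linarith [hu.1, hu.2]
  have h7 : L * |s + u - (s + t)| ≤ r / 2 := by
    calc L * |s + u - (s + t)| ≤ (L + 1) * (r / (2 * (L + 1))) := by gcongr; linarith
      _ = r / 2 := by field_simp
  rw [Metric.mem_ball, dist_eq_norm] at h1 ⊢
  calc ‖x (s + u) - p.1‖ = ‖(x (s + u) - x (s + t)) + (x (s + t) - p.1)‖ := by abel_nf
    _ ≤ ‖x (s + u) - x (s + t)‖ + ‖x (s + t) - p.1‖ := norm_add_le _ _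
    _ < r := by linarith

theorem exists_lim [MetricSpace Γ] [CompactSpace Γ] {f : Eucl n × Γ → Eucl n}
    {domf : Set (Eucl n × Γ)} (hd : IsClosed domf) (hf : ContinuousOn f domf)
    {B : Set (Eucl n)} (hB : IsCompact B) {L : ℝ} (hL : 0 ≤ L) {x : ℝ → Eucl n}
    {σ : ℝ → Γ} (h : BTraj f domf B L x σ) {τD : ℝ} {N₀ : ℕ} (hσ : σ ∈ SA Γ τD N₀)
    {U : Ultrafilter ℝ} (hU : (U : Filter ℝ) ≤ atTop) :
    ∃ y : ℝ → Eucl n, ∃ ρ : ℝ → Γ, LimSys f domf B (goodSet σ U) y ρ ∧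
      ∀ t, Tendsto (fun s => (x (s + t), σ (s + t))) (U : Filter ℝ) (𝓝 (y t, ρ t)) := by
  have hK : IsCompact (domf ∩ (B ×ˢ (univ : Set Γ))) := (hB.prod isCompact_univ).inter_left hd
  have hex : ∀ t, ∃ p ∈ domf ∩ (B ×ˢ (univ : Set Γ)),
      Tendsto (fun s => (x (s + t), σ (s + t))) (U : Filter ℝ) (𝓝 p) := by
    intro t
    have := hK.ultrafilter_le_nhds (U.map (fun s => (x (s + t), σ (s + t)))) (by
      rw [le_principal_iff]
      have hev : ∀ᶠ s in (U : Filter ℝ),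
          (x (s + t), σ (s + t)) ∈ domf ∩ (B ×ˢ (univ : Set Γ)) := by
        filter_upwards [ev_nonneg hU t] with s hs
        exact ⟨h.mem _ hs, h.memB _ hs, mem_univ _⟩
      exact hev)
    simpa [Tendsto] using this
  choose p hp hlim using hex
  have hlimx : ∀ t, Tendsto (fun s => x (s + t)) (U : Filter ℝ) (𝓝 (p t).1) := fun t =>
    (continuous_fst.tendsto _).comp (hlim t)
  have hlimσ : ∀ t, Tendsto (fun s => σ (s + t)) (U : Filter ℝ) (𝓝 (p t).2) := fun t =>
    (continuous_snd.tendsto _).comp (hlim t)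
  refine ⟨fun t => (p t).1, fun t => (p t).2, ?_, hlim⟩
  refine ⟨⟨?_, ?_, ?_, bad_countable hσ U⟩, ?_, ?_, fun t => (hp t).1, fun t => (hp t).2.1⟩
  · intro t ht
    obtain ⟨ε, hε, hc⟩ := good_const hσ.1 ht
    obtain ⟨ε', hε', hj⟩ := ht
    refine ⟨min ε ε', lt_min hε hε', fun u hu => ⟨?_, ?_⟩⟩
    · refine ⟨min (u - (t - ε')) (t + ε' - u), lt_min ?_ ?_, ?_⟩
      · linarith [hu.1, min_le_right ε ε']
      · linarith [hu.2, min_le_right ε ε']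
      · filter_upwards [hj] with s hs v hv
        refine hs v ⟨?_, ?_⟩
        · linarith [hv.1, min_le_left (u - (t - ε')) (t + ε' - u)]
        · linarith [hv.2, min_le_right (u - (t - ε')) (t + ε' - u)]
    · refine tendsto_nhds_unique ((hlimσ t).congr' ?_) (hlimσ u) |>.symm
      filter_upwards [hc] with s hs
      exact (hs u ⟨by linarith [hu.1, min_le_left ε ε'],
        by linarith [hu.2, min_le_left ε ε']⟩).symm
  · intro t
    obtain ⟨ε, hε, hg⟩ := bad_nbhd hσ U t
    exact ⟨ε, hε, fun u hu => hg u ⟨by linarith [hu.1], hu.2⟩ hu.1.ne'⟩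
  · intro t
    obtain ⟨ε, hε, hg⟩ := bad_nbhd hσ U t
    exact ⟨ε, hε, fun u hu => hg u ⟨hu.1, by linarith [hu.2]⟩ hu.2.ne⟩
  · have : LipschitzWith (Real.toNNReal L) (fun t => (p t).1) := by
      refine LipschitzWith.of_dist_le_mul (fun a b => ?_)
      rw [dist_eq_norm, Real.dist_eq, Real.coe_toNNReal _ hL]
      refine le_of_tendsto ((hlimx a).sub (hlimx b)).norm ?_
      filter_upwards [ev_nonneg hU a, ev_nonneg hU b] with s h1 h2
      have := h.lip (s + b) h2 (s + a) h1
      simpa using this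
    exact this.continuous
  · intro t ht
    rw [hasDerivAt_iff_isLittleO, Asymptotics.isLittleO_iff]
    intro c hc
    have hcont := hf (p t) (hp t).1
    have hN : {q | q ∈ domf → ‖f q - f (p t)‖ < c} ∈ 𝓝 (p t) := by
      have h1 := hcont.tendsto.eventually (Metric.ball_mem_nhds (f (p t)) hc)
      rw [eventually_nhdsWithin_iff] at h1
      filter_upwards [h1] with q hq hqd
      simpa [dist_eq_norm] using hq hqd
    obtain ⟨δ, hδ, hev⟩ := ev_near hL h hσ.1 hU ht (hlim t) hN
    filter_upwards [Ioo_mem_nhds (show t - δ < t by linarith) (show t < t + δ by linarith)]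
      with u hu
    have hl : Tendsto (fun s => ‖x (s + u) - x (s + t) - (u - t) • f (p t)‖) (U : Filter ℝ)
        (𝓝 ‖(p u).1 - (p t).1 - (u - t) • f (p t)‖) :=
      (((hlimx u).sub (hlimx t)).sub tendsto_const_nhds).norm
    refine le_of_tendsto hl ?_
    filter_upwards [hev] with s hs
    have htt : t ∈ Ioo (t - δ) (t + δ) := ⟨by linarith, by linarith⟩
    obtain ⟨hi, heq⟩ := h.intg (s + t) (hs t htt).1 (s + u) (hs u hu).1
    have e1 : x (s + u) - x (s + t) - (u - t) • f (p t) =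
        ∫ v in (s + t)..(s + u), (f (x v, σ v) - f (p t)) := by
      rw [intervalIntegral.integral_sub hi intervalIntegrable_const,
        intervalIntegral.integral_const, heq, add_sub_cancel_left]
      congr 2; ring
    rw [e1]
    have := intervalIntegral.norm_integral_le_of_norm_le_const (a := s + t) (b := s + u)
      (f := fun v => f (x v, σ v) - f (p t)) (C := c) (fun v hv => by
        have hv' : v - s ∈ Ioo (t - δ) (t + δ) := by
          have h1 : min (s + t) (s + u) < v := hv.1
          have h2 : v ≤ max (s + t) (s + u) := hv.2
          rw [min_add_add_left] at h1
          rw [max_add_add_left] at h2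
          exact ⟨by linarith [lt_min htt.1 hu.1], by linarith [max_lt htt.2 hu.2]⟩
        have h3 := hs _ hv'
        rw [add_sub_cancel] at h3
        exact (h3.2.2 (h.mem v h3.1)).le)
    rw [add_sub_add_left_eq_sub] at this
    simpa [Real.norm_eq_abs] using this

end exlim

section conv
variable {n : ℕ} {Γ : Type*}

theorem LimSys.mono [TopologicalSpace Γ] {f : Eucl n × Γ → Eucl n} {domf : Set (Eucl n × Γ)}
    {O O' : Set (Eucl n)} {G : Set ℝ} {x : ℝ → Eucl n} {σ : ℝ → Γ}
    (L : LimSys f domf O G x σ) (h : O ⊆ O') : LimSys f domf O' G x σ :=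
  ⟨L.good, L.cont, L.deriv, L.mem, fun t => h (L.memO t)⟩

theorem anti_lim {g : ℝ → ℝ} {A : Set ℝ} (hanti : AntitoneOn g A) (hbd : ∀ t ∈ A, 0 ≤ g t)
    {l : Filter ℝ} {u : ℝ → ℝ} (hu : Tendsto u l atTop) (hA : ∀ᶠ s in l, u s ∈ A) :
    Tendsto (fun s => g (u s)) l (𝓝 (sInf (g '' A))) := by
  rcases l.eq_or_neBot with rfl | hne
  · exact tendsto_bot
  obtain ⟨s₀, hs₀⟩ := hA.exists
  have hne' : (g '' A).Nonempty := ⟨_, mem_image_of_mem _ hs₀⟩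
  have hbd' : BddBelow (g '' A) := ⟨0, by rintro _ ⟨t, ht, rfl⟩; exact hbd t ht⟩
  rw [tendsto_order]
  refine ⟨fun c hc => ?_, fun c hc => ?_⟩
  · filter_upwards [hA] with s hs
    exact hc.trans_le (csInf_le hbd' (mem_image_of_mem _ hs))
  · obtain ⟨_, ⟨t, ht, rfl⟩, hlt⟩ := exists_lt_of_csInf_lt hne' hc
    filter_upwards [hA, hu.eventually_ge_atTop t] with s hs hst
    exact (hanti ht hs hst).trans_lt hlt

theorem tendsto_shift {U : Ultrafilter ℝ} (hU : (U : Filter ℝ) ≤ atTop) (t : ℝ) :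
    Tendsto (fun s => s + t) (U : Filter ℝ) atTop :=
  (tendsto_atTop_add_const_right _ _ tendsto_id).mono_left hU

theorem conv_core [MetricSpace Γ] [CompactSpace Γ] {f : Eucl n × Γ → Eucl n}
    {domf : Set (Eucl n × Γ)} (hd : IsClosed domf) (hf : ContinuousOn f domf)
    {B : Set (Eucl n)} (hB : IsCompact B) {L : ℝ} (hL : 0 ≤ L) {x : ℝ → Eucl n}
    {σ : ℝ → Γ} (h : BTraj f domf B L x σ) (hσ : σ ∈ SAall Γ)
    (H : ∀ U : Ultrafilter ℝ, (U : Filter ℝ) ≤ atTop → ∀ y ρ,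
      LimSys f domf B (goodSet σ U) y ρ →
      (∀ t, Tendsto (fun s => (x (s + t), σ (s + t))) (U : Filter ℝ) (𝓝 (y t, ρ t))) →
      ∀ t, y t = 0) : Tendsto x atTop (𝓝 0) := by
  simp only [SAall, mem_iUnion] at hσ
  obtain ⟨τD, hτ, N₀, hσ⟩ := hσ
  rw [tendsto_iff_ultrafilter]
  intro U hU
  obtain ⟨y, ρ, hL', hlim⟩ := exists_lim hd hf hB hL h hσ hU
  have h0 := H U hU y ρ hL' hlim 0
  have := (continuous_fst.tendsto _).comp (hlim 0)
  simpa [Function.comp_def, h0] using this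

theorem LimSys.constV [TopologicalSpace Γ] {f : Eucl n × Γ → Eucl n}
    {domf domV : Set (Eucl n × Γ)} {V : Eucl n × Γ → ℝ} {G : Set ℝ} {y : ℝ → Eucl n} {ρ : ℝ → Γ}
    (L : LimSys f domf (Oset domV) G y ρ) (hd : IsClosed domf)
    (hV : ContinuousOn V (domf ∩ (Oset domV ×ˢ (univ : Set Γ))))
    {c : Γ → ℝ} (hc : ∀ t, V (y t, ρ t) = c (ρ t)) {a b : ℝ} {γ : Γ} (hab : a < b)
    (hm : Md G ρ a b γ) : ∀ t ∈ Icc a b, V (y t, γ) = c γ := by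
  intro t ht
  have hcont : ContinuousOn (fun t => V (y t, γ)) (Icc a b) :=
    hV.comp (L.cont.prodMk continuous_const).continuousOn
      (fun u hu => ⟨L.piece_mem hd hab hm u hu, L.memO u, mem_univ _⟩)
  have hcl := hcont.preimage_isClosed_of_isClosed isClosed_Icc (isClosed_singleton (x := c γ))
  have := closure_minimal (t := Icc a b ∩ (fun t => V (y t, γ)) ⁻¹' {c γ}) (s := G ∩ Ioo a b) (fun u hu => by
    refine ⟨Ioo_subset_Icc_self hu.2, ?_⟩
    have := hc u
    rw [hm u hu.1 hu.2] at this
    exact this) hcl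
  exact (this (L.good.dense hab ht)).2

theorem LimSys.W_zero [TopologicalSpace Γ] {f : Eucl n × Γ → Eucl n}
    {domf domV : Set (Eucl n × Γ)} {V W : Eucl n × Γ → ℝ} {G : Set ℝ} {y : ℝ → Eucl n}
    {ρ : ℝ → Γ} (L : LimSys f domf (Oset domV) G y ρ) (hd : IsClosed domf)
    (hf : ContinuousOn f domf) (hcl : ClassVFun V domV domf) (hw : Wineq f V W domV domf)
    {k a b : ℝ} {γ : Γ} (hab : a < b)
    (hm : Md G ρ a b γ) (hk : ∀ t ∈ Icc a b, V (y t, γ) = k) :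
    ∀ t ∈ Icc a b, W (y t, γ) = 0 := by
  intro t ht
  have hO : y t ∈ Ogamma domV domf γ := ⟨L.memO t, L.piece_mem hd hab hm t ht⟩
  have h1 := (hcl.diff γ (y t) hO).hasFDerivAt.comp_hasDerivWithinAt t
    (L.piece_deriv hd hf hab hm ht)
  have h2 : HasDerivWithinAt ((fun ξ' => V (ξ', γ)) ∘ y) 0 (Icc a b) t :=
    (hasDerivWithinAt_const t (Icc a b) k).congr (fun u hu => hk u hu) (hk t ht)
  have h3 := (uniqueDiffOn_Icc hab t ht).eq_deriv _ h1 h2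
  obtain ⟨h4, h5⟩ := hw γ (y t) hO
  rw [h3] at h4
  linarith

theorem V_zero_prop {α₁ α₂ : ℝ → ℝ} (h₁ : ClassK α₁) (h₂ : ClassK α₂) {V : Eucl n × Γ → ℝ}
    {domV domf : Set (Eucl n × Γ)}
    (hb : ∀ γ : Γ, ∀ ξ ∈ Ogamma domV domf γ, α₁ ‖ξ‖ ≤ V (ξ, γ) ∧ V (ξ, γ) ≤ α₂ ‖ξ‖)
    {γ : Γ} {ξ η : Eucl n} (hξ : ξ ∈ Ogamma domV domf γ) (hη : η ∈ Ogamma domV domf γ)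
    (heq : V (ξ, γ) = V (η, γ)) (h0 : ξ = 0) : η = 0 := by
  have h3 := (hb γ ξ hξ).2
  rw [h0, norm_zero, h₂.zero, ← h0, heq] at h3
  have h4 := (hb γ η hη).1
  by_contra hne
  have h5 := h₁.mono (self_mem_Ici) (norm_nonneg η) (norm_pos_iff.2 hne)
  rw [h₁.zero] at h5
  linarith

theorem traj_setup [TopologicalSpace Γ] [CompactSpace Γ] {f : Eucl n × Γ → Eucl n}
    {domf : Set (Eucl n × Γ)} (hd : IsClosed domf) (hf : ContinuousOn f domf)
    {T : Set ((ℝ → Eucl n) × (ℝ → Γ))} (hT : ForwardCompleteFamily f domf T)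
    {xs} (hxs : xs ∈ T) {R : ℝ} (hx : ∀ t, 0 ≤ t → ‖xs.1 t‖ ≤ R) :
    IsSwitchingSignal xs.2 ∧ ∃ L ≥ 0, BTraj f domf (Metric.closedBall 0 R) L xs.1 xs.2 := by
  obtain ⟨I, hI, htr⟩ := hT xs hxs
  exact ⟨htr.signal, exists_btraj hd hf (isCompact_closedBall _ _) hI htr
    (fun t ht => by rw [mem_closedBall_zero_iff]; exact hx t ht)⟩

variable [MetricSpace Γ] [CompactSpace Γ] {f : Eucl n × Γ → Eucl n}
    {domf domV : Set (Eucl n × Γ)} {V W : Eucl n × Γ → ℝ} {T : Set ((ℝ → Eucl n) × (ℝ → Γ))}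

theorem weak_lim (hT : ForwardCompleteFamily f domf T)
    (hp : WeakLyapunovPair f domf V domV W T) {xs} (hxs : xs ∈ T) {R : ℝ}
    (hR : Metric.closedBall 0 R ⊆ Oset domV) (hx : ∀ t, 0 ≤ t → ‖xs.1 t‖ ≤ R) :
    ∃ c, ∀ U : Ultrafilter ℝ, (U : Filter ℝ) ≤ atTop → ∀ t,
      Tendsto (fun s => V (xs.1 (s + t), xs.2 (s + t))) (U : Filter ℝ) (𝓝 c) := by
  have hO : ∀ t, 0 ≤ t → xs.1 t ∈ Oset domV := fun t ht =>
    hR (by rw [mem_closedBall_zero_iff]; exact hx t ht)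
  obtain ⟨α₁, α₂, h₁, h₂, hb⟩ := hp.bounds
  refine ⟨sInf ((fun t => V (xs.1 t, xs.2 t)) '' Ici 0), fun U hU t => ?_⟩
  refine anti_lim (g := fun t => V (xs.1 t, xs.2 t)) ?_ ?_ (tendsto_shift hU t) (ev_nonneg hU t)
  · intro a ha b hb' hab
    exact hp.decreasing xs hxs a b ha hab (fun u hu => hO u (ha.trans hu.1))
      (left_mem_Icc.2 hab) (right_mem_Icc.2 hab) hab
  · intro t ht
    exact (h₁.nonneg (norm_nonneg _)).trans (hb _ _ ⟨hO t ht, mem_domf hT hxs ht⟩).1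

theorem conv1 (hd : IsClosed domf) (hf : ContinuousOn f domf)
    (hT : ForwardCompleteFamily f domf T)
    (hp : WeakLyapunovPair f domf V domV W T)
    (hV : ContinuousOn V (domf ∩ (Oset domV ×ˢ (univ : Set Γ))))
    (hA : CondA f domf domV W) (hB : CondB' f V domf domV W)
    {xs} (hxs : xs ∈ T) (hσ : xs.2 ∈ SAall Γ) {R : ℝ}
    (hR : Metric.closedBall 0 R ⊆ Oset domV) (hx : ∀ t, 0 ≤ t → ‖xs.1 t‖ ≤ R) :
    Tendsto xs.1 atTop (𝓝 0) := by
  obtain ⟨hsig, L, hL, hbt⟩ := traj_setup hd hf hT hxs hx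
  obtain ⟨c, hc⟩ := weak_lim hT hp hxs hR hx
  obtain ⟨α₁, α₂, h₁, h₂, hb⟩ := hp.bounds
  refine conv_core hd hf (isCompact_closedBall _ _) hL hbt hσ (fun U hU y ρ hLS hlim => ?_)
  have hLO := hLS.mono hR
  have hyc : ∀ t, V (y t, ρ t) = (fun _ : Γ => c) (ρ t) := by
    intro t
    have hm : (y t, ρ t) ∈ domf ∩ (Oset domV ×ˢ (univ : Set Γ)) :=
      ⟨hLO.mem t, hLO.memO t, mem_univ _⟩
    refine tendsto_nhds_unique ((hV _ hm).tendsto.comp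
      (tendsto_nhdsWithin_iff.2 ⟨hlim t, ?_⟩)) (hc U hU t)
    filter_upwards [ev_nonneg hU t] with s hs
    exact ⟨hbt.mem _ hs, hR (hbt.memB _ hs), mem_univ _⟩
  have hk : ∀ a b γ, a < b → Md (goodSet xs.2 U) ρ a b γ → ∀ t ∈ Icc a b, V (y t, γ) = c :=
    fun a b γ hab hm => hLO.constV (c := fun _ : Γ => c) hd hV hyc hab hm
  refine hLO.zero (W := W) hd hf hA ?_ ?_ ?_
  · intro a b γ hab hm
    exact hLO.W_zero hd hf hp.classV hp.wineq hab hm (hk a b γ hab hm)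
  · intro γ γ' a b d hab hbd hm hm' hne hb1 hb2
    exact hB γ γ' hne c ⟨⟨⟨hb1, hb2⟩, hk a b γ hab hm b (right_mem_Icc.2 hab.le)⟩,
      hk b d γ' hbd hm' b (left_mem_Icc.2 hbd.le)⟩
  · intro a b γ hab hm t₁ ht₁ h0 t ht
    exact V_zero_prop h₁ h₂ hb ⟨hLO.memO _, hLO.piece_mem hd hab hm t₁ ht₁⟩
      ⟨hLO.memO _, hLO.piece_mem hd hab hm t ht⟩
      ((hk a b γ hab hm t₁ ht₁).trans (hk a b γ hab hm t ht).symm) h0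

theorem conv3 [Finite Γ] (hd : IsClosed domf) (hf : ContinuousOn f domf)
    (hT : ForwardCompleteFamily f domf T)
    (hp : FWeakLyapunovPair f domf V domV W T)
    (hA : CondA f domf domV W) (hB : CondB f domf domV W)
    {xs} (hxs : xs ∈ T) (hσ : xs.2 ∈ SAall Γ) {R : ℝ}
    (hR : Metric.closedBall 0 R ⊆ Oset domV) (hx : ∀ t, 0 ≤ t → ‖xs.1 t‖ ≤ R) :
    Tendsto xs.1 atTop (𝓝 0) := by
  obtain ⟨hsig, L, hL, hbt⟩ := traj_setup hd hf hT hxs hx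
  obtain ⟨α₁, α₂, h₁, h₂, hb⟩ := hp.bounds
  have hO : ∀ t, 0 ≤ t → xs.1 t ∈ Oset domV := fun t ht => hR (hbt.memB t ht)
  have hV : ContinuousOn V (domf ∩ (Oset domV ×ˢ (univ : Set Γ))) := by
    rintro ⟨ξ, γ⟩ ⟨h1, h2, -⟩
    have hdiff := (hp.classV.diff γ ξ ⟨h2, h1⟩).continuousAt
    have : ContinuousAt V (ξ, γ) := by
      rw [ContinuousAt, nhds_prod_eq, nhds_discrete Γ, prod_pure, tendsto_map'_iff]
      exact hdiff
    exact this.continuousWithinAt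
  refine conv_core hd hf (isCompact_closedBall _ _) hL hbt hσ (fun U hU y ρ hLS hlim => ?_)
  have hLO := hLS.mono hR
  set c : Γ → ℝ := fun γ =>
    sInf ((fun t => V (xs.1 t, γ)) '' (Ici 0 ∩ {t | xs.2 t = γ})) with hcdef
  have hyc : ∀ t, V (y t, ρ t) = c (ρ t) := by
    intro t
    have hm : (y t, ρ t) ∈ domf ∩ (Oset domV ×ˢ (univ : Set Γ)) :=
      ⟨hLO.mem t, hLO.memO t, mem_univ _⟩
    have hσl : ∀ᶠ s in (U : Filter ℝ), xs.2 (s + t) = ρ t := by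
      have := (continuous_snd.tendsto _).comp (hlim t)
      rw [nhds_discrete, tendsto_pure] at this
      exact this
    have l1 : Tendsto (fun s => V (xs.1 (s + t), ρ t)) (U : Filter ℝ) (𝓝 (c (ρ t))) := by
      refine anti_lim (g := fun u => V (xs.1 u, ρ t)) ?_ ?_ (tendsto_shift hU t) ?_
      · intro a ha b hb' hab
        exact hp.decreasing xs hxs a b ha.1 hab (fun u hu => hO u (le_trans ha.1 hu.1)) (ρ t)
          ⟨left_mem_Icc.2 hab, ha.2⟩ ⟨right_mem_Icc.2 hab, hb'.2⟩ hab
      · intro u hu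
        have hmem := mem_domf hT hxs hu.1
        rw [show xs.2 u = ρ t from hu.2] at hmem
        exact (h₁.nonneg (norm_nonneg _)).trans (hb _ _ ⟨hO u hu.1, hmem⟩).1
      · filter_upwards [ev_nonneg hU t, hσl] with s hs1 hs2
        exact ⟨hs1, hs2⟩
    refine tendsto_nhds_unique ((hV _ hm).tendsto.comp
      (tendsto_nhdsWithin_iff.2 ⟨hlim t, ?_⟩)) (l1.congr' ?_)
    · filter_upwards [ev_nonneg hU t] with s hs
      exact ⟨hbt.mem _ hs, hR (hbt.memB _ hs), mem_univ _⟩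
    · filter_upwards [hσl] with s hs
      simp [hs]
  have hk : ∀ a b γ, a < b → Md (goodSet xs.2 U) ρ a b γ → ∀ t ∈ Icc a b, V (y t, γ) = c γ :=
    fun a b γ hab hm => hLO.constV hd hV hyc hab hm
  refine hLO.zero (W := W) hd hf hA ?_ ?_ ?_
  · intro a b γ hab hm
    exact hLO.W_zero hd hf hp.classV hp.wineq hab hm (hk a b γ hab hm)
  · intro γ γ' a b d hab hbd hm hm' hne hb1 hb2
    exact hB γ γ' hne ⟨hb1, hb2⟩
  · intro a b γ hab hm t₁ ht₁ h0 t ht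
    exact V_zero_prop h₁ h₂ hb ⟨hLO.memO _, hLO.piece_mem hd hab hm t₁ ht₁⟩
      ⟨hLO.memO _, hLO.piece_mem hd hab hm t ht⟩
      ((hk a b γ hab hm t₁ ht₁).trans (hk a b γ hab hm t ht).symm) h0

/-- Decrease of `V` along a mode-constant arc. -/
theorem drop (hf : ContinuousOn f domf) (hcl : ClassVFun V domV domf)
    (hw : Wineq f V W domV domf) {L : ℝ} {B : Set (Eucl n)}
    (hB : B ⊆ Oset domV) {x : ℝ → Eucl n} {σ : ℝ → Γ} (h : BTraj f domf B L x σ)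
    {a b w : ℝ} {γ : Γ} (ha : 0 ≤ a) (hab : a ≤ b) (hσ : ∀ v ∈ Icc a b, σ v = γ)
    (hW : ∀ v ∈ Icc a b, w ≤ W (x v, γ)) : V (x b, γ) - V (x a, γ) ≤ -w * (b - a) := by
  have hmem : ∀ v ∈ Icc a b, (x v, γ) ∈ domf := by
    intro v hv
    have := h.mem v (ha.trans hv.1)
    rwa [hσ v hv] at this
  have hOg : ∀ v ∈ Icc a b, x v ∈ Ogamma domV domf γ := fun v hv =>
    ⟨hB (h.memB v (ha.trans hv.1)), hmem v hv⟩
  have hxc : ContinuousOn x (Icc a b) := by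
    have : LipschitzOnWith (Real.toNNReal L) x (Icc a b) := by
      refine LipschitzOnWith.of_dist_le_mul (fun u hu v hv => ?_)
      rw [dist_eq_norm, Real.dist_eq]
      refine (h.lip v (ha.trans hv.1) u (ha.trans hu.1)).trans ?_
      gcongr
      exact Real.le_coe_toNNReal L
    exact this.continuousOn
  have hfc : ContinuousOn (fun v => f (x v, γ)) (Icc a b) :=
    hf.comp (hxc.prodMk continuousOn_const) hmem
  have hint : ∀ v ∈ Icc a b, x v = x a + ∫ s in a..v, f (x s, γ) := by
    intro v hv
    rw [(h.intg a ha v (ha.trans hv.1)).2]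
    congr 1
    refine intervalIntegral.integral_congr (fun s hs => ?_)
    rw [uIcc_of_le hv.1] at hs
    show f (x s, σ s) = f (x s, γ)
    rw [hσ s ⟨hs.1, hs.2.trans hv.2⟩]
  have hder : ∀ v ∈ Icc a b, HasDerivWithinAt x (f (x v, γ)) (Icc a b) v := by
    intro v hv
    have : Fact (v ∈ Icc a b) := ⟨hv⟩
    have h1 : HasDerivWithinAt (fun u => ∫ s in a..u, f (x s, γ)) (f (x v, γ)) (Icc a b) v := by
      refine intervalIntegral.integral_hasDerivWithinAt_right
        ((hfc.mono ?_).intervalIntegrable) ?_ (hfc v hv)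
      · rw [uIcc_of_le hv.1]; exact Icc_subset_Icc_right hv.2
      · exact hfc.stronglyMeasurableAtFilter_nhdsWithin measurableSet_Icc v
    exact (h1.const_add (x a)).congr hint (hint v hv)
  have hVd : ∀ v ∈ Icc a b, HasDerivWithinAt ((fun ξ' => V (ξ', γ)) ∘ x)
      (fderiv ℝ (fun ξ' => V (ξ', γ)) (x v) (f (x v, γ))) (Icc a b) v := fun v hv =>
    (hcl.diff γ (x v) (hOg v hv)).hasFDerivAt.comp_hasDerivWithinAt v (hder v hv)
  have hVi : ∀ v ∈ interior (Icc a b), HasDerivAt ((fun ξ' => V (ξ', γ)) ∘ x)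
      (fderiv ℝ (fun ξ' => V (ξ', γ)) (x v) (f (x v, γ))) v := fun v hv =>
    (hVd v (interior_subset hv)).hasDerivAt (mem_interior_iff_mem_nhds.1 hv)
  refine (convex_Icc a b).image_sub_le_mul_sub_of_deriv_le
    (f := (fun ξ' => V (ξ', γ)) ∘ x) (C := -w)
    (fun v hv => (hVd v hv).continuousWithinAt)
    (fun v hv => (hVi v hv).differentiableAt.differentiableWithinAt)
    (fun v hv => ?_) a (left_mem_Icc.2 hab) b (right_mem_Icc.2 hab) hab
  rw [(hVi v hv).deriv]
  have h1 := (hw γ (x v) (hOg v (interior_subset hv))).1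
  have h2 := hW v (interior_subset hv)
  linarith

theorem conv2 (hd : IsClosed domf) (hf : ContinuousOn f domf) (hE0 : AssumpE0 f domf)
    (hU0 : AssumpU f domf)
    (hT : ForwardCompleteFamily f domf T)
    (hp : WeakLyapunovPair f domf V domV W T)
    (hWc : ContinuousOn W (domf ∩ (Oset domV ×ˢ (univ : Set Γ))))
    (hA : CondA f domf domV W) (hB : CondB f domf domV W)
    {xs} (hxs : xs ∈ T) (hσ : xs.2 ∈ SAall Γ) {R : ℝ}
    (hR : Metric.closedBall 0 R ⊆ Oset domV) (hx : ∀ t, 0 ≤ t → ‖xs.1 t‖ ≤ R) :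
    Tendsto xs.1 atTop (𝓝 0) := by
  obtain ⟨hsig, L, hL, hbt⟩ := traj_setup hd hf hT hxs hx
  obtain ⟨c, hc⟩ := weak_lim hT hp hxs hR hx
  refine conv_core hd hf (isCompact_closedBall _ _) hL hbt hσ (fun U hU y ρ hLS hlim => ?_)
  have hLO := hLS.mono hR
  have hWgood : ∀ t ∈ goodSet xs.2 U, W (y t, ρ t) = 0 := by
    intro t ht
    have hm : (y t, ρ t) ∈ domf ∩ (Oset domV ×ˢ (univ : Set Γ)) :=
      ⟨hLO.mem t, hLO.memO t, mem_univ _⟩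
    have hnn := (hp.wineq (ρ t) (y t) ⟨hm.2.1, hm.1⟩).2
    by_contra hne
    have hpos : 0 < W (y t, ρ t) := lt_of_le_of_ne hnn (Ne.symm hne)
    set w := W (y t, ρ t) with hwdef
    have hN : {q | q ∈ domf ∩ (Oset domV ×ˢ (univ : Set Γ)) → w / 2 < W q} ∈ 𝓝 (y t, ρ t) := by
      have h1 := (hWc _ hm).tendsto.eventually (lt_mem_nhds (show w / 2 < w by linarith))
      rw [eventually_nhdsWithin_iff] at h1
      exact h1
    obtain ⟨δ, hδ, hev⟩ := ev_near hL hbt hsig hU ht (hlim t) hN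
    have hlim2 := (hc U hU (t + δ / 2)).sub (hc U hU t)
    have hle : c - c ≤ -(w / 2) * (δ / 2) := by
      refine le_of_tendsto hlim2 ?_
      filter_upwards [hev] with s hs
      have hin : ∀ v ∈ Icc (s + t) (s + (t + δ / 2)), v - s ∈ Ioo (t - δ) (t + δ) := fun v hv =>
        ⟨by linarith [hv.1], by linarith [hv.2]⟩
      have hs' : ∀ v ∈ Icc (s + t) (s + (t + δ / 2)), 0 ≤ v ∧ xs.2 v = xs.2 (s + t) ∧
          w / 2 < W (xs.1 v, xs.2 v) := by
        intro v hv
        have h3 := hs _ (hin v hv)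
        rw [add_sub_cancel] at h3
        exact ⟨h3.1, h3.2.1, h3.2.2 ⟨hbt.mem v h3.1, hR (hbt.memB v h3.1), mem_univ _⟩⟩
      have hab : s + t ≤ s + (t + δ / 2) := by linarith
      have := drop hf hp.classV hp.wineq hR hbt (γ := xs.2 (s + t)) (w := w / 2)
        (hs' _ (left_mem_Icc.2 hab)).1 hab (fun v hv => (hs' v hv).2.1) (fun v hv => by
          have := (hs' v hv).2.2.le
          rwa [(hs' v hv).2.1] at this)
      rw [(hs' _ (right_mem_Icc.2 hab)).2.1]
      refine this.trans (le_of_eq ?_)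
      ring
    have : 0 < w / 2 * (δ / 2) := by positivity
    linarith
  refine hLO.zero (W := W) hd hf hA ?_ ?_ ?_
  · intro a b γ hab hm t ht
    have hcont : ContinuousOn (fun t => W (y t, γ)) (Icc a b) :=
      hWc.comp (hLO.cont.prodMk continuous_const).continuousOn
        (fun u hu => ⟨hLO.piece_mem hd hab hm u hu, hLO.memO u, mem_univ _⟩)
    have hcl := hcont.preimage_isClosed_of_isClosed isClosed_Icc (isClosed_singleton (x := (0:ℝ)))
    have := closure_minimal (t := Icc a b ∩ (fun t => W (y t, γ)) ⁻¹' {0})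
      (s := goodSet xs.2 U ∩ Ioo a b) (fun u hu => by
      refine ⟨Ioo_subset_Icc_self hu.2, ?_⟩
      have := hWgood u hu.1
      rw [hm u hu.1 hu.2] at this
      exact this) hcl
    exact (this (hLO.good.dense hab ht)).2
  · intro γ γ' a b d hab hbd hm hm' hne hb1 hb2
    exact hB γ γ' hne ⟨hb1, hb2⟩
  · intro a b γ hab hm t₁ ht₁ h0 t ht
    have h0d : ((0 : Eucl n), γ) ∈ domf := by
      have := hLO.piece_mem hd hab hm t₁ ht₁
      rwa [h0] at this
    have hsol := hLO.isSol (γ := γ) hd hf t₁ (Icc (a - t₁) (b - t₁)) (fun u hu v hv =>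
      ⟨a, b, hab, hm, ⟨by linarith [hu.1], by linarith [hu.2]⟩,
        ⟨by linarith [hv.1], by linarith [hv.2]⟩⟩)
    have hsol' : IsSolOn (fun ξ => f (ξ, γ)) {ξ | (ξ, γ) ∈ domf} (fun t => y (t + t₁))
        (Icc (a - t₁) (b - t₁)) := ⟨hsol.1, fun u hu => (hsol.2.1 u hu).2, hsol.2.2⟩
    have hzero : IsSolOn (fun ξ => f (ξ, γ)) {ξ | (ξ, γ) ∈ domf} (fun _ => (0 : Eucl n))
        (Icc (a - t₁) (b - t₁)) := by
      refine ⟨continuousOn_const, fun _ _ => h0d, fun u _ v _ => ?_⟩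
      simp [hE0 γ h0d]
    have := hU0 γ h0d (Icc (a - t₁) (b - t₁)) ordConnected_Icc
      ⟨by linarith [ht₁.1], by linarith [ht₁.2]⟩ _ _ hsol' hzero (by simpa using h0) rfl (t - t₁)
      ⟨by linarith [ht.1], by linarith [ht.2]⟩
    simpa using this

theorem Oset_open (h : ClassVFun V domV domf) : IsOpen (Oset domV) := by
  have : Oset domV = ⋃ γ : Γ, {ξ : Eucl n | (ξ, γ) ∈ domV} := by
    ext ξ; simp [Oset]
  rw [this]
  exact isOpen_iUnion h.openD

theorem exists_ball (h : ClassVFun V domV domf) (h0 : (0 : Eucl n) ∈ Oset domV) :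
    ∃ R > 0, Metric.closedBall 0 R ⊆ Oset domV :=
  Metric.nhds_basis_closedBall.mem_iff.1 ((Oset_open h).mem_nhds h0)

theorem las_of (hT : ForwardCompleteFamily f domf T) {R : ℝ} (hR : 0 < R) {β : ℝ → ℝ}
    (hβ : ClassK β) (h : EstIn T (Metric.closedBall 0 R) β)
    (hc : ∀ xs ∈ T, (∀ t, 0 ≤ t → ‖xs.1 t‖ ≤ R) → Tendsto xs.1 atTop (𝓝 0)) :
    FamilyLAS T := by
  obtain ⟨r, hr, hs⟩ := local_stab hT hR hβ h
  exact ⟨⟨r, hr, β, hβ, fun xs hxs t₀ h0 hx t ht => (hs xs hxs t₀ h0 hx t ht).1⟩, r, hr,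
    fun xs hxs hx => hc xs hxs (fun t ht => (hs xs hxs 0 le_rfl hx.le t ht).2)⟩

theorem gas_of {β : ℝ → ℝ}
    (hβ : ClassKInf β) (h : EstIn T univ β)
    (hc : ∀ xs ∈ T, ∀ R, (∀ t, 0 ≤ t → ‖xs.1 t‖ ≤ R) → Tendsto xs.1 atTop (𝓝 0)) :
    FamilyGAS T := by
  have h' : ∀ xs ∈ T, ∀ t₀ : ℝ, 0 ≤ t₀ → ∀ t : ℝ, t₀ ≤ t → ‖xs.1 t‖ ≤ β ‖xs.1 t₀‖ :=
    fun xs hxs t₀ h0 t ht => h xs hxs t₀ t h0 ht (fun _ _ => mem_univ _)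
  exact ⟨⟨β, hβ, h'⟩, fun xs hxs => hc xs hxs _ (h' xs hxs 0 le_rfl)⟩

theorem weak_local (hT : ForwardCompleteFamily f domf T)
    (hp : WeakLyapunovPair f domf V domV W T) :
    ∃ R > 0, Metric.closedBall 0 R ⊆ Oset domV ∧ ∃ β, ClassK β ∧
      EstIn T (Metric.closedBall 0 R) β := by
  obtain ⟨R, hR, hsub⟩ := exists_ball hp.classV hp.zeroMem
  obtain ⟨α₁, α₂, h₁, h₂, hb⟩ := hp.bounds
  obtain ⟨e, he⟩ := classK_orderIso h₁ hR.le
  have he0 : e 0 = 0 := by rw [he 0 le_rfl hR.le, h₁.zero]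
  exact ⟨R, hR, hsub, _, gainFn_classK e he0 h₂, weak_est hT hp hsub
    (fun ξ hξ => he _ (norm_nonneg _) (mem_closedBall_zero_iff.1 hξ)) hb⟩

theorem fweak_local [Finite Γ] (hT : ForwardCompleteFamily f domf T)
    (hp : FWeakLyapunovPair f domf V domV W T) :
    ∃ R > 0, Metric.closedBall 0 R ⊆ Oset domV ∧ ∃ β, ClassK β ∧
      EstIn T (Metric.closedBall 0 R) β := by
  obtain ⟨R, hR, hsub⟩ := exists_ball hp.classV hp.zeroMem
  obtain ⟨α₁, α₂, h₁, h₂, hb⟩ := hp.bounds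
  obtain ⟨e, he⟩ := classK_orderIso h₁ hR.le
  have he0 : e 0 = 0 := by rw [he 0 le_rfl hR.le, h₁.zero]
  exact ⟨R, hR, hsub, _, (classKInf_iterate (gainFn_classKInf e he0 h₂) _).toClassK,
    fweak_est hT hp hsub
    (fun ξ hξ => he _ (norm_nonneg _) (mem_closedBall_zero_iff.1 hξ)) he0 h₂ hb⟩

theorem weak_global (hT : ForwardCompleteFamily f domf T)
    (hp : WeakLyapunovPair f domf V domV W T) (hO : Oset domV = univ)
    (hr : RadiallyUnbounded V domV domf) : ∃ β, ClassKInf β ∧ EstIn T univ β := by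
  obtain ⟨α₁, α₂, h₁, h₂, hb⟩ := hr
  obtain ⟨e, he⟩ := classKInf_orderIso h₁
  have he0 : e 0 = 0 := by rw [he 0 le_rfl, h₁.zero]
  exact ⟨_, gainFn_classKInf e he0 h₂.toClassK, weak_est hT hp hO.ge
    (fun ξ hξ => he _ (norm_nonneg _)) hb⟩

theorem fweak_global [Finite Γ] (hT : ForwardCompleteFamily f domf T)
    (hp : FWeakLyapunovPair f domf V domV W T) (hO : Oset domV = univ)
    (hr : RadiallyUnbounded V domV domf) : ∃ β, ClassKInf β ∧ EstIn T univ β := by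
  obtain ⟨α₁, α₂, h₁, h₂, hb⟩ := hr
  obtain ⟨e, he⟩ := classKInf_orderIso h₁
  have he0 : e 0 = 0 := by rw [he 0 le_rfl, h₁.zero]
  exact ⟨_, classKInf_iterate (gainFn_classKInf e he0 h₂.toClassK) _, fweak_est hT hp hO.ge
    (fun ξ hξ => he _ (norm_nonneg _)) he0 h₂.toClassK hb⟩

end conv

noncomputable section
theorem stability_criteria_average_dwell_time
    {n : ℕ} {Γ : Type*} [MetricSpace Γ] [CompactSpace Γ]
    (f : Eucl n × Γ → Eucl n) (domf : Set (Eucl n × Γ))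
    (hdomf : IsClosed domf) (hf : ContinuousOn f domf)
    (hE0 : AssumpE0 f domf)
    (T : Set ((ℝ → Eucl n) × (ℝ → Γ)))
    (hT : ForwardCompleteFamily f domf T)
    (hTσ : ∀ xs ∈ T, xs.2 ∈ SAall Γ) :
    ((∃ V : Eucl n × Γ → ℝ, ∃ domV : Set (Eucl n × Γ), ∃ W : Eucl n × Γ → ℝ,
        WeakLyapunovPair f domf V domV W T ∧
        ContinuousOn V (domf ∩ (Oset domV ×ˢ (Set.univ : Set Γ))) ∧
        CondA f domf domV W ∧ CondB' f V domf domV W) → FamilyLAS T) ∧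
    ((AssumpU f domf ∧
      ∃ V : Eucl n × Γ → ℝ, ∃ domV : Set (Eucl n × Γ), ∃ W : Eucl n × Γ → ℝ,
        WeakLyapunovPair f domf V domV W T ∧
        ContinuousOn W (domf ∩ (Oset domV ×ˢ (Set.univ : Set Γ))) ∧
        CondA f domf domV W ∧ CondB f domf domV W) → FamilyLAS T) ∧
    ((Finite Γ ∧
      ∃ V : Eucl n × Γ → ℝ, ∃ domV : Set (Eucl n × Γ), ∃ W : Eucl n × Γ → ℝ,
        FWeakLyapunovPair f domf V domV W T ∧
        CondA f domf domV W ∧ CondB f domf domV W) → FamilyLAS T) ∧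
    ((∃ V : Eucl n × Γ → ℝ, ∃ domV : Set (Eucl n × Γ), ∃ W : Eucl n × Γ → ℝ,
        WeakLyapunovPair f domf V domV W T ∧
        ContinuousOn V (domf ∩ (Oset domV ×ˢ (Set.univ : Set Γ))) ∧
        CondA f domf domV W ∧ CondB' f V domf domV W ∧
        Oset domV = Set.univ ∧ RadiallyUnbounded V domV domf) → FamilyGAS T) ∧
    ((AssumpU f domf ∧
      ∃ V : Eucl n × Γ → ℝ, ∃ domV : Set (Eucl n × Γ), ∃ W : Eucl n × Γ → ℝ,
        WeakLyapunovPair f domf V domV W T ∧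
        ContinuousOn W (domf ∩ (Oset domV ×ˢ (Set.univ : Set Γ))) ∧
        CondA f domf domV W ∧ CondB f domf domV W ∧
        Oset domV = Set.univ ∧ RadiallyUnbounded V domV domf) → FamilyGAS T) ∧
    ((Finite Γ ∧
      ∃ V : Eucl n × Γ → ℝ, ∃ domV : Set (Eucl n × Γ), ∃ W : Eucl n × Γ → ℝ,
        FWeakLyapunovPair f domf V domV W T ∧
        CondA f domf domV W ∧ CondB f domf domV W ∧
        Oset domV = Set.univ ∧ RadiallyUnbounded V domV domf) → FamilyGAS T) := by
  refine ⟨?_, ?_, ?_, ?_, ?_, ?_⟩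
  · rintro ⟨V, domV, W, hp, hV, hA, hB⟩
    obtain ⟨R, hR, hsub, β, hβ, hest⟩ := weak_local hT hp
    exact las_of hT hR hβ hest (fun xs hxs hx =>
      conv1 hdomf hf hT hp hV hA hB hxs (hTσ xs hxs) hsub hx)
  · rintro ⟨hU, V, domV, W, hp, hW, hA, hB⟩
    obtain ⟨R, hR, hsub, β, hβ, hest⟩ := weak_local hT hp
    exact las_of hT hR hβ hest (fun xs hxs hx =>
      conv2 hdomf hf hE0 hU hT hp hW hA hB hxs (hTσ xs hxs) hsub hx)
  · rintro ⟨hfin, V, domV, W, hp, hA, hB⟩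
    obtain ⟨R, hR, hsub, β, hβ, hest⟩ := fweak_local hT hp
    exact las_of hT hR hβ hest (fun xs hxs hx =>
      conv3 hdomf hf hT hp hA hB hxs (hTσ xs hxs) hsub hx)
  · rintro ⟨V, domV, W, hp, hV, hA, hB, hO, hr⟩
    obtain ⟨β, hβ, hest⟩ := weak_global hT hp hO hr
    exact gas_of hβ hest (fun xs hxs R hx =>
      conv1 hdomf hf hT hp hV hA hB hxs (hTσ xs hxs) (hO ▸ Set.subset_univ _) hx)
  · rintro ⟨hU, V, domV, W, hp, hW, hA, hB, hO, hr⟩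
    obtain ⟨β, hβ, hest⟩ := weak_global hT hp hO hr
    exact gas_of hβ hest (fun xs hxs R hx =>
      conv2 hdomf hf hE0 hU hT hp hW hA hB hxs (hTσ xs hxs) (hO ▸ Set.subset_univ _) hx)
  · rintro ⟨hfin, V, domV, W, hp, hA, hB, hO, hr⟩
    obtain ⟨β, hβ, hest⟩ := fweak_global hT hp hO hr
    exact gas_of hβ hest (fun xs hxs R hx =>
      conv3 hdomf hf hT hp hA hB hxs (hTσ xs hxs) (hO ▸ Set.subset_univ _) hx)
end
end
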